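/- arXiv:2306.16079 — 7 statements merged into one kernel-verified Lean document; each statement's English description precedes it below -/
import Mathlib

section
/- Let $n \ge 1$ and $1 \le j \le n$. The number of words $w \in \{a,b\}^n$ whose generated deck $\sigma(w)$ begins with the sequence $1,2,\dots,j-1$ equals $2^{n-j+1}+j-1$, and the number of words whose generated deck begins with $1,2,\dots,j$ equals $2^{n-j}+j$. Consequently, for $W$ uniform on $\{a,b\}^n$, the conditional probability that the $j$-th card is $j$ given that the first $j-1$ cards are $1,2,\dots,j-1$ equals $(2^{n-j}+j)/(2^{n-j+1}+j-1)$, and this quantity is strictly greater than $1/2$. -/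
/-- Helper for the word-to-deck map. -/
def deckAux : List Bool → ℕ → ℕ → List ℕ
  | [], _, _ => []
  | true :: w, i, j => i :: deckAux w (i + 1) j
  | false :: w, i, j => j :: deckAux w i (j + 1)

/-- The deck generated by a word `w ∈ {a,b}^n` (`true = a`, `false = b`). -/
def deck (w : List Bool) : List ℕ := deckAux w 1 (w.count true + 1)

theorem deckAux_false (w : List Bool) (i m : ℕ) (h : w.count true = 0) (hm : m ≤ w.length) (j : ℕ) :
    (deckAux w i j).take m = List.range' j m := by
  induction w generalizing j m with
  | nil => simp at hm; subst hm; simp [deckAux]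
  | cons b w ih =>
    cases b with
    | true => simp at h
    | false =>
      cases m with
      | zero => simp
      | succ m =>
        simp only [deckAux, List.take_succ_cons, List.range'_succ]
        rw [ih m (by simpa using h) (by simpa using hm)]

theorem count_prefix (n m i : ℕ) (hm : m ≤ n) :
    (Finset.univ.filter fun w : Fin n → Bool =>
      (deckAux (List.ofFn w) i ((List.ofFn w).count true + i)).take m = List.range' i m).card
      = 2 ^ (n - m) + m := by
  induction n generalizing m i with
  | zero =>
    obtain rfl : m = 0 := by omega
    simp
  | succ n ih =>
    cases m with
    | zero => simp
    | succ m =>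
      have ht := ih m (i + 1) (by omega)
      rw [Finset.card_filter] at ht ⊢
      rw [← Equiv.sum_comp (Fin.consEquiv fun _ => Bool), Fintype.sum_prod_type, Fintype.sum_bool]
      have e1 : ∀ w : Fin n → Bool,
          ((deckAux (List.ofFn (Fin.consEquiv (fun _ => Bool) (true, w))) i
            ((List.ofFn (Fin.consEquiv (fun _ => Bool) (true, w))).count true + i)).take (m + 1)
              = List.range' i (m + 1)) ↔
          ((deckAux (List.ofFn w) (i + 1) ((List.ofFn w).count true + (i + 1))).take m
              = List.range' (i + 1) m) := by
        intro w
        simp [Fin.consEquiv, List.ofFn_succ, deckAux, List.range'_succ, add_assoc, add_comm 1 i]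
      have e2 : ∀ w : Fin n → Bool,
          ((deckAux (List.ofFn (Fin.consEquiv (fun _ => Bool) (false, w))) i
            ((List.ofFn (Fin.consEquiv (fun _ => Bool) (false, w))).count true + i)).take (m + 1)
              = List.range' i (m + 1)) ↔ w = fun _ => false := by
        intro w
        have hc : (List.ofFn w).count true = 0 ↔ w = fun _ => false := by
          rw [List.count_eq_zero, funext_iff]
          simp [List.mem_ofFn]
        rw [← hc]
        have h0 : List.ofFn (Fin.consEquiv (fun _ => Bool) (false, w)) = false :: List.ofFn w := by
          simp [Fin.consEquiv, List.ofFn_succ]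
        rw [h0]
        simp only [deckAux, List.take_succ_cons, List.range'_succ, List.cons.injEq]
        constructor
        · rintro ⟨h, -⟩
          simpa using h
        · intro h
          refine ⟨by simpa using h, ?_⟩
          rw [deckAux_false _ _ _ h (by simp; omega)]
          simp [h]
      simp only [e1, e2]
      rw [ht]
      simp
      omega

/-- The number of words whose generated deck begins with `1,…,j-1` is
`2^(n-j+1) + j - 1`, the number whose deck begins with `1,…,j` is
`2^(n-j) + j`; hence the conditional probability that the `j`-th card is `j`
given that the first `j-1` cards are `1,…,j-1` equals
`(2^(n-j)+j)/(2^(n-j+1)+j-1) > 1/2`. -/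
theorem stmt1 (n j : ℕ) (hj1 : 1 ≤ j) (hjn : j ≤ n) :
    (Finset.univ.filter fun w : Fin n → Bool =>
        (deck (List.ofFn w)).take (j - 1) = List.range' 1 (j - 1)).card
      = 2 ^ (n - j + 1) + j - 1 ∧
    (Finset.univ.filter fun w : Fin n → Bool =>
        (deck (List.ofFn w)).take j = List.range' 1 j).card
      = 2 ^ (n - j) + j ∧
    ((Finset.univ.filter fun w : Fin n → Bool =>
        (deck (List.ofFn w)).take j = List.range' 1 j).card : ℚ) /
      ((Finset.univ.filter fun w : Fin n → Bool =>
        (deck (List.ofFn w)).take (j - 1) = List.range' 1 (j - 1)).card : ℚ)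
      = ((2 ^ (n - j) + j : ℕ) : ℚ) / ((2 ^ (n - j + 1) + j - 1 : ℕ) : ℚ) ∧
    1 / 2 < ((2 ^ (n - j) + j : ℕ) : ℚ) / ((2 ^ (n - j + 1) + j - 1 : ℕ) : ℚ) := by
  have hA := count_prefix n (j - 1) 1 (by omega)
  have hB := count_prefix n j 1 hjn
  have hA' : (Finset.univ.filter fun w : Fin n → Bool =>
        (deck (List.ofFn w)).take (j - 1) = List.range' 1 (j - 1)).card
      = 2 ^ (n - j + 1) + j - 1 := by
    have e : n - (j - 1) = n - j + 1 := by omega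
    rw [e] at hA
    unfold deck
    rw [hA]
    omega
  have hB' : (Finset.univ.filter fun w : Fin n → Bool =>
        (deck (List.ofFn w)).take j = List.range' 1 j).card
      = 2 ^ (n - j) + j := hB
  refine ⟨hA', hB', by rw [hA', hB'], ?_⟩
  have hp : 0 < 2 ^ (n - j + 1) + j - 1 := by
    have : 0 < 2 ^ (n - j + 1) := by positivity
    omega
  have hlt : 2 ^ (n - j + 1) + j - 1 < 2 * (2 ^ (n - j) + j) := by
    rw [pow_succ]
    omega
  rw [div_lt_div_iff₀ (by norm_num) (by exact_mod_cast hp)]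
  have : ((2 ^ (n - j + 1) + j - 1 : ℕ) : ℚ) < ((2 * (2 ^ (n - j) + j) : ℕ) : ℚ) := by
    exact_mod_cast hlt
  rw [Nat.cast_mul] at this
  push_cast at this ⊢
  linarith
end

section
/- Let $n \ge 1$ and let $\sigma : \{a,b\}^n \to S_n$ be the word-to-deck map. Then the preimage of the identity permutation $\mathrm{id}_n$ under $\sigma$ consists exactly of the $n+1$ words $a^k b^{n-k}$, $0 \le k \le n$, and $\sigma$ is injective on the complement of this set; in particular, the one-time riffle shuffle produces exactly $2^n - n$ distinct permutations, namely the identity (with multiplicity $n+1$) and $2^n - n - 1$ further permutations, each with multiplicity $1$. -/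
theorem all_false_of_count (w : List Bool) (h : w.count true = 0) :
    w = List.replicate w.length false := by
  rw [List.eq_replicate_iff]
  refine ⟨rfl, fun b hb => ?_⟩
  cases b
  · rfl
  · exact absurd hb (List.count_eq_zero.mp h)

/-- words of the form `a^k b^(n-k)` -/
def SortedWord (w : List Bool) : Prop :=
  ∃ k ≤ w.length, w = List.replicate k true ++ List.replicate (w.length - k) false

theorem sortedWord_nil : SortedWord [] := ⟨0, by simp, by simp⟩

theorem sortedWord_cons (w : List Bool) (h : SortedWord w) : SortedWord (true :: w) := by
  obtain ⟨k, hk, h⟩ := h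
  refine ⟨k + 1, by simpa using hk, ?_⟩
  have e : (true :: w).length - (k + 1) = w.length - k := by simp
  rw [e, List.replicate_succ, List.cons_append, ← h]

theorem sortedWord_of_count (w : List Bool) (h : w.count true = 0) : SortedWord w :=
  ⟨0, by simp, by simpa using all_false_of_count w h⟩

theorem deckAux_inj (w : List Bool) : ∀ (w' : List Bool) (i j : ℕ),
    i + w.count true ≤ j → i + w'.count true ≤ j → deckAux w i j = deckAux w' i j → w = w' := by
  induction w with
  | nil =>
    intro w' i j _ _ h
    rcases w' with _ | ⟨_ | _, w'⟩ <;> simp [deckAux] at h ⊢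
  | cons b w ih =>
    intro w' i j h1 h2 h
    rcases w' with _ | ⟨b', w'⟩
    · cases b <;> simp [deckAux] at h
    · cases b <;> cases b' <;> simp [deckAux] at h h1 h2 ⊢
      · exact ih w' i (j + 1) (by omega) (by omega) h
      · omega
      · omega
      · exact ih w' (i + 1) j (by omega) (by omega) h

theorem deckAux_sorted (w : List Bool) : ∀ (w' : List Bool) (i j j' : ℕ),
    i + w.count true = j → i + w'.count true = j' → j < j' →
    deckAux w i j = deckAux w' i j' → SortedWord w := by
  induction w with
  | nil => intros; exact sortedWord_nil
  | cons b w ih =>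
    intro w' i j j' h1 h2 hlt h
    rcases w' with _ | ⟨b', w'⟩
    · cases b <;> simp [deckAux] at h
    · cases b <;> cases b' <;> simp [deckAux] at h h1 h2 ⊢
      · omega
      · exact sortedWord_of_count _ (by simp; omega)
      · omega
      · exact sortedWord_cons _ (ih w' (i + 1) j j' (by omega) (by omega) hlt h)

theorem deckAux_id (w : List Bool) : ∀ (i j : ℕ), i + w.count true = j →
    deckAux w i j = List.range' i w.length → SortedWord w := by
  induction w with
  | nil => intros; exact sortedWord_nil
  | cons b w ih =>
    intro i j h1 h
    cases b <;> simp [deckAux, List.range'_succ] at h h1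
    · exact sortedWord_of_count _ (by simp; omega)
    · exact sortedWord_cons _ (ih (i + 1) j (by omega) h)

theorem deckAux_false_s2 (m : ℕ) : ∀ i j : ℕ,
    deckAux (List.replicate m false) i j = List.range' j m := by
  induction m with
  | zero => intros; rfl
  | succ m ih => intro i j; simp [List.replicate_succ, deckAux, List.range'_succ, ih]

theorem deckAux_rep (k m : ℕ) : ∀ i : ℕ,
    deckAux (List.replicate k true ++ List.replicate m false) i (i + k)
      = List.range' i (k + m) := by
  induction k with
  | zero => intro i; simp [deckAux_false_s2]
  | succ k ih =>
    intro i
    have e : i + (k + 1) = i + 1 + k := by omega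
    have e' : k + 1 + m = (k + m) + 1 := by omega
    simp only [List.replicate_succ, List.cons_append, deckAux]
    rw [e', List.range'_succ, e, ih]

theorem deck_id_iff (w : List Bool) : deck w = List.range' 1 w.length ↔ SortedWord w := by
  constructor
  · exact deckAux_id w 1 _ (by omega)
  · rintro ⟨k, hk, h⟩
    have hc : w.count true = k := by rw [h]; simp [List.count_replicate]
    unfold deck
    rw [hc, add_comm k 1]
    have := deckAux_rep k (w.length - k) 1
    rw [← h] at this
    rw [this]
    congr 1
    omega

theorem deck_inj (w w' : List Bool) (hl : w.length = w'.length)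
    (hne : deck w ≠ List.range' 1 w.length) (h : deck w = deck w') : w = w' := by
  rcases lt_trichotomy (w.count true) (w'.count true) with hlt | heq | hlt
  · exact absurd ((deck_id_iff w).mpr
      (deckAux_sorted w w' 1 _ _ (by omega) (by omega) (by omega) h)) hne
  · unfold deck at h
    rw [← heq] at h
    exact deckAux_inj w w' 1 _ (by omega) (by omega) h
  · refine absurd ?_ hne
    rw [h, hl]
    exact (deck_id_iff w').mpr
      (deckAux_sorted w' w 1 _ _ (by omega) (by omega) (by omega) h.symm)

theorem ofFn_sorted (n k : ℕ) (hk : k ≤ n) :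
    List.ofFn (fun i : Fin n => decide (i.val < k))
      = List.replicate k true ++ List.replicate (n - k) false := by
  apply List.ext_getElem
  · simp; omega
  · intro i h1 h2
    simp [List.getElem_append]

/-- The preimage of the identity permutation `(1,2,…,n)` under the
word-to-deck map consists exactly of the `n+1` words `a^k b^(n-k)`,
`0 ≤ k ≤ n`; the map is injective elsewhere; hence exactly `2^n - n`
distinct permutations arise: the identity (multiplicity `n+1`) and
`2^n - n - 1` further permutations, each with multiplicity `1`. -/
theorem stmt2 (n : ℕ) (hn : 1 ≤ n) :
    (∀ w : Fin n → Bool,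
        deck (List.ofFn w) = List.range' 1 n ↔
          ∃ k ≤ n, List.ofFn w = List.replicate k true ++ List.replicate (n - k) false) ∧
    (Finset.univ.filter fun w : Fin n → Bool =>
        deck (List.ofFn w) = List.range' 1 n).card = n + 1 ∧
    (∀ w w' : Fin n → Bool, deck (List.ofFn w) ≠ List.range' 1 n →
        deck (List.ofFn w) = deck (List.ofFn w') → w = w') ∧
    (Finset.univ.image fun w : Fin n → Bool => deck (List.ofFn w)).card = 2 ^ n - n ∧
    ((Finset.univ.image fun w : Fin n → Bool => deck (List.ofFn w)) \
        {List.range' 1 n}).card = 2 ^ n - n - 1 := by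
  have H1 : ∀ w : Fin n → Bool, deck (List.ofFn w) = List.range' 1 n ↔
      ∃ k ≤ n, List.ofFn w = List.replicate k true ++ List.replicate (n - k) false := by
    intro w
    have := deck_id_iff (List.ofFn w)
    simpa [SortedWord] using this
  have H2 : (Finset.univ.filter fun w : Fin n → Bool =>
        deck (List.ofFn w) = List.range' 1 n).card = n + 1 := by
    have e : (Finset.univ.filter fun w : Fin n → Bool => deck (List.ofFn w) = List.range' 1 n)
        = (Finset.range (n + 1)).image (fun k => fun i : Fin n => decide (i.val < k)) := by
      ext w
      simp only [Finset.mem_filter, Finset.mem_univ, true_and, Finset.mem_image,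
        Finset.mem_range, H1]
      constructor
      · rintro ⟨k, hk, h⟩
        refine ⟨k, by omega, List.ofFn_injective ?_⟩
        rw [h, ofFn_sorted n k hk]
      · rintro ⟨k, hk, rfl⟩
        exact ⟨k, by omega, ofFn_sorted n k (by omega)⟩
    rw [e, Finset.card_image_of_injOn, Finset.card_range]
    intro k hk l hl h
    simp only [Finset.coe_range, Set.mem_Iio] at hk hl
    by_contra hne
    rcases Nat.lt_or_gt_of_ne hne with hlt | hlt
    · have := congrFun h ⟨k, by omega⟩
      simp at this
      omega
    · have := congrFun h ⟨l, by omega⟩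
      simp at this
      omega
  have H3 : ∀ w w' : Fin n → Bool, deck (List.ofFn w) ≠ List.range' 1 n →
        deck (List.ofFn w) = deck (List.ofFn w') → w = w' := by
    intro w w' hne h
    exact List.ofFn_injective (deck_inj _ _ (by simp) (by simpa using hne) h)
  have H5 : ((Finset.univ.image fun w : Fin n → Bool => deck (List.ofFn w)) \
        {List.range' 1 n}).card = 2 ^ n - n - 1 := by
    have e : ((Finset.univ.image fun w : Fin n → Bool => deck (List.ofFn w)) \
        {List.range' 1 n}) = (Finset.univ.filter fun w : Fin n → Bool =>
          ¬ deck (List.ofFn w) = List.range' 1 n).image (fun w => deck (List.ofFn w)) := by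
      ext l
      simp only [Finset.mem_sdiff, Finset.mem_image, Finset.mem_univ, true_and,
        Finset.mem_singleton, Finset.mem_filter]
      constructor
      · rintro ⟨⟨w, rfl⟩, h⟩
        exact ⟨w, h, rfl⟩
      · rintro ⟨w, h, rfl⟩
        exact ⟨⟨w, rfl⟩, h⟩
    rw [e, Finset.card_image_of_injOn]
    · have := Finset.card_filter_add_card_filter_not (s := (Finset.univ : Finset (Fin n → Bool)))
        (fun w : Fin n → Bool => deck (List.ofFn w) = List.range' 1 n)
      rw [H2] at this
      simp only [Finset.card_univ, Fintype.card_pi, Fintype.card_bool, Finset.prod_const,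
        Fintype.card_fin] at this
      omega
    · intro w hw w' _ h
      exact H3 w w' (by simpa using hw) h
  refine ⟨H1, H2, H3, ?_, H5⟩
  have hmem : List.range' 1 n ∈
      (Finset.univ.image fun w : Fin n → Bool => deck (List.ofFn w)) := by
    rw [Finset.mem_image]
    exact ⟨fun i => decide (i.val < n), Finset.mem_univ _,
      (H1 _).mpr ⟨n, le_rfl, ofFn_sorted n n le_rfl⟩⟩
  have h6 := Finset.card_sdiff_add_card_eq_card (Finset.singleton_subset_iff.mpr hmem)
  rw [H5, Finset.card_singleton] at h6
  have := Nat.lt_two_pow_self (n := n)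
  omega
end

section
/- For all $m_1, m_2 \ge 0$ the polynomials $F_{m_1,m_2}(q) := \sum_w q^{\hat c(w)}$ (sum over all words with $m_1$ letters $a$ and $m_2$ letters $b$) satisfy: $F_{m_1,m_2}(q) = F_{m_2,m_1}(q)$; $F_{m_1,0}(q) = q^{m_1}$; and $F_{m_1,m_2}(q) = q\,F_{m_1-1,m_2}(q) + F_{m_1,m_2-1}(q)$ for all $m_1 \ge m_2 \ge 1$. -/
/-- Two-color majority-guessing correct count (`true = a`, `false = b`):
one guesses `a` iff the remaining word contains at least as many `a`'s as
`b`'s; a guess is correct if it matches the first letter. -/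
def chat : List Bool → ℕ
  | [] => 0
  | x :: w =>
      chat w + if decide ((x :: w).count true ≥ (x :: w).count false) = x then 1 else 0

/-- The words with `m₁` letters `a` and `m₂` letters `b`. -/
def wordsWith (m₁ m₂ : ℕ) : Finset (Fin (m₁ + m₂) → Bool) :=
  Finset.univ.filter fun w => (List.ofFn w).count true = m₁

/-- `F m₁ m₂ = ∑_w q^(ĉ(w))`, summed over all words with `m₁` `a`'s and `m₂` `b`'s. -/
noncomputable def F (m₁ m₂ : ℕ) : Polynomial ℚ :=
  ∑ w ∈ wordsWith m₁ m₂, Polynomial.X ^ chat (List.ofFn w)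

/-- Generating polynomial over words of length `n` with `k` letters `a`. -/
noncomputable def SS (n k : ℕ) : Polynomial ℚ :=
  ∑ w : Fin n → Bool, if (List.ofFn w).count true = k then
    Polynomial.X ^ chat (List.ofFn w) else 0

lemma F_eq_SS (a b : ℕ) : F a b = SS (a + b) a := by
  unfold F SS wordsWith
  rw [Finset.sum_filter]

lemma SS_succ_aux (n k : ℕ) : SS (n + 1) k =
    (∑ w : Fin n → Bool, if (List.ofFn w).count true + 1 = k then
      (Polynomial.X : Polynomial ℚ) ^ chat (true :: List.ofFn w) else 0) +
    (∑ w : Fin n → Bool, if (List.ofFn w).count true = k then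
      (Polynomial.X : Polynomial ℚ) ^ chat (false :: List.ofFn w) else 0) := by
  unfold SS
  rw [← Fintype.sum_equiv (Fin.consEquiv (fun _ : Fin (n + 1) => Bool)) _ _ (fun _ => rfl),
    Fintype.sum_prod_type, Fintype.sum_bool]
  simp [Fin.consEquiv, List.ofFn_cons]

lemma count_ofFn (n : ℕ) (w : Fin n → Bool) :
    (List.ofFn w).count true + (List.ofFn w).count false = n := by
  have h := List.count_true_add_count_false (List.ofFn w)
  simpa using h

lemma SS_succ_succ (n k : ℕ) : SS (n + 1) (k + 1) =
    Polynomial.X ^ (if n + 1 ≤ 2 * (k + 1) then 1 else 0) * SS n k +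
    Polynomial.X ^ (if n + 1 ≤ 2 * (k + 1) then 0 else 1) * SS n (k + 1) := by
  rw [SS_succ_aux]
  unfold SS
  rw [Finset.mul_sum, Finset.mul_sum]
  congr 1
  · refine Finset.sum_congr rfl fun w _ => ?_
    have h := count_ofFn n w
    by_cases hk : (List.ofFn w).count true = k
    · by_cases hc : n + 1 ≤ 2 * (k + 1)
      · have : (List.ofFn w).count false ≤ k + 1 := by omega
        simp [hk, hc, chat, this, pow_succ']
      · have : ¬ (List.ofFn w).count false ≤ k + 1 := by omega
        simp [hk, hc, chat, this]
    · simp [hk]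
  · refine Finset.sum_congr rfl fun w _ => ?_
    have h := count_ofFn n w
    by_cases hk : (List.ofFn w).count true = k + 1
    · by_cases hc : n + 1 ≤ 2 * (k + 1)
      · have : (List.ofFn w).count false + 1 ≤ k + 1 := by omega
        have h2 : (List.ofFn w).count false ≤ k := by omega
        simp [hk, hc, chat, h2]
      · have : ¬ (List.ofFn w).count false + 1 ≤ k + 1 := by omega
        have h2 : k < (List.ofFn w).count false := by omega
        simp [hk, hc, chat, h2, pow_succ']
    · simp [hk]

lemma SS_succ_zero (n : ℕ) : SS (n + 1) 0 = Polynomial.X * SS n 0 := by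
  rw [SS_succ_aux]
  unfold SS
  rw [Finset.mul_sum]
  simp only [Nat.add_eq_zero_iff, one_ne_zero, and_false, if_false, Finset.sum_const_zero, zero_add]
  refine Finset.sum_congr rfl fun w _ => ?_
  by_cases hk : (List.ofFn w).count true = 0
  · rw [if_pos hk, if_pos hk]
    simp [chat, hk, pow_succ']
  · rw [if_neg hk, if_neg hk, mul_zero]

lemma SS_big (n k : ℕ) (h : n < k) : SS n k = 0 := by
  unfold SS
  refine Finset.sum_eq_zero fun w _ => ?_
  have := count_ofFn n w
  rw [if_neg (by omega)]

lemma SS_zero : SS 0 0 = 1 := by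
  simp [SS, chat]

lemma F_zero_left (m : ℕ) : F 0 m = Polynomial.X ^ m := by
  rw [F_eq_SS, Nat.zero_add]
  induction m with
  | zero => simp [SS_zero]
  | succ m ih => rw [SS_succ_zero, ih, pow_succ']

lemma F_zero_right (m : ℕ) : F m 0 = Polynomial.X ^ m := by
  rw [F_eq_SS, Nat.add_zero]
  induction m with
  | zero => simp [SS_zero]
  | succ m ih =>
    rw [SS_succ_succ, ih, SS_big m (m + 1) (by omega), if_pos (by omega), pow_one, mul_zero,
      add_zero, pow_succ']

lemma F_rec_ge (a b : ℕ) (h : b ≤ a) :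
    F (a + 1) (b + 1) = Polynomial.X * F a (b + 1) + F (a + 1) b := by
  rw [F_eq_SS, F_eq_SS, F_eq_SS, show a + 1 + (b + 1) = (a + b + 1) + 1 by omega, SS_succ_succ,
    if_pos (by omega), if_pos (by omega), show a + (b + 1) = a + b + 1 by omega,
    show a + 1 + b = a + b + 1 by omega]
  simp

lemma F_rec_lt (a b : ℕ) (h : a < b) :
    F (a + 1) (b + 1) = F a (b + 1) + Polynomial.X * F (a + 1) b := by
  rw [F_eq_SS, F_eq_SS, F_eq_SS, show a + 1 + (b + 1) = (a + b + 1) + 1 by omega, SS_succ_succ,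
    if_neg (by omega), if_neg (by omega), show a + (b + 1) = a + b + 1 by omega,
    show a + 1 + b = a + b + 1 by omega]
  simp

lemma F_symm (a b : ℕ) : F a b = F b a := by
  induction a generalizing b with
  | zero => rw [F_zero_left, F_zero_right]
  | succ a iha =>
    induction b with
    | zero => rw [F_zero_left, F_zero_right]
    | succ b ihb =>
      rcases lt_trichotomy a b with h | h | h
      · rw [F_rec_lt a b h, F_rec_ge b a h.le, iha, ihb, add_comm]
      · rw [h]
      · rw [F_rec_ge a b h.le, F_rec_lt b a h, iha, ihb, add_comm]

/-- Symmetry, initial values, and the basic recurrence of the generating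
polynomials `F_{m₁,m₂}(q)` of the two-color majority-guessing correct counts. -/
theorem stmt3 :
    (∀ m₁ m₂ : ℕ, F m₁ m₂ = F m₂ m₁) ∧
    (∀ m₁ : ℕ, F m₁ 0 = Polynomial.X ^ m₁) ∧
    (∀ m₁ m₂ : ℕ, 1 ≤ m₂ → m₂ ≤ m₁ →
      F m₁ m₂ = Polynomial.X * F (m₁ - 1) m₂ + F m₁ (m₂ - 1)) := by
  refine ⟨F_symm, F_zero_right, fun a b hb hab => ?_⟩
  obtain ⟨b, rfl⟩ := Nat.exists_eq_add_of_le' hb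
  obtain ⟨a, rfl⟩ := Nat.exists_eq_add_of_le' (le_trans hb hab)
  simpa using F_rec_ge a b (by omega)
end

section
/- For every $n \ge 1$ the polynomial $D_n(q) := \sum_{w \in \{a,b\}^n} q^{g(w)}$ satisfies the recurrence $D_n(q) = q\,D_{n-1}(q) + q^n + \sum_{j=0}^{n-2} F_{n-1-j,\,j}(q)$, with initial value $D_0(q) = 1$, where $F_{m_1,m_2}(q) = \sum_w q^{\hat c(w)}$ is the generating polynomial of the two-color majority-guessing correct count. -/
/-- Riffle-shuffle correct-guess count: `g [] = 0`, `g (a w') = 1 + g w'`,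
`g (b^n) = n`, and `g (b w') = ĉ(w')` for `w' ≠ b^(n-1)`. -/
def g : List Bool → ℕ
  | [] => 0
  | true :: w => 1 + g w
  | false :: w => if w = List.replicate w.length false then w.length + 1 else chat w

/-- `D n = ∑_{w ∈ {a,b}^n} q^(g(w))`. -/
noncomputable def D (n : ℕ) : Polynomial ℚ :=
  ∑ w : Fin n → Bool, Polynomial.X ^ g (List.ofFn w)

theorem F_eq (m a b : ℕ) (h : a + b = m) :
    F a b = ∑ w : Fin m → Bool with (List.ofFn w).count true = a,
      Polynomial.X ^ chat (List.ofFn w) := by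
  subst h
  rfl

theorem ofFn_eq_replicate_iff (m : ℕ) (w : Fin m → Bool) :
    List.ofFn w = List.replicate (List.ofFn w).length false ↔ (List.ofFn w).count true = 0 := by
  rw [List.count_eq_zero, List.eq_replicate_iff]
  simp only [true_and]
  constructor
  · intro h h1
    simpa using h _ h1
  · intro h b hb
    cases b with
    | false => rfl
    | true => exact absurd hb h

theorem sum_b (m : ℕ) :
    ∑ w : Fin m → Bool, (Polynomial.X : Polynomial ℚ) ^ g (false :: List.ofFn w) =
      Polynomial.X ^ (m + 1) + ∑ j ∈ Finset.range m, F (m - j) j := by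
  have h0 : ∀ w : Fin m → Bool, (List.ofFn w).count true = 0 ↔ w = fun _ => false := by
    intro w
    rw [← ofFn_eq_replicate_iff, List.length_ofFn, ← List.ofFn_const, List.ofFn_inj]
  rw [← Finset.sum_filter_add_sum_filter_not Finset.univ
    (fun w : Fin m → Bool => (List.ofFn w).count true = 0)]
  congr 1
  · have : (Finset.univ.filter fun w : Fin m → Bool => (List.ofFn w).count true = 0)
        = {fun _ => false} := by
      ext w
      rw [Finset.mem_filter, h0]
      simp
    rw [this, Finset.sum_singleton]
    simp [g]
  · rw [← Finset.sum_fiberwise_of_maps_to (t := Finset.range m)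
      (g := fun w : Fin m → Bool => m - (List.ofFn w).count true)]
    · refine Finset.sum_congr rfl fun j hj => ?_
      rw [Finset.mem_range] at hj
      rw [F_eq m (m - j) j (by omega), Finset.filter_filter]
      refine Finset.sum_congr ?_ ?_
      · ext w
        have : (List.ofFn w).count true ≤ m := by
          simpa using (List.count_le_length (a := true) (l := List.ofFn w))
        simp only [Finset.mem_filter, Finset.mem_univ, true_and]
        omega
      · intro w hw
        rw [Finset.mem_filter] at hw
        rw [g, if_neg]
        rw [ofFn_eq_replicate_iff]
        omega
    · intro w hw
      have : (List.ofFn w).count true ≤ m := by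
        simpa using (List.count_le_length (a := true) (l := List.ofFn w))
      simp only [Finset.mem_filter, Finset.mem_univ, true_and] at hw
      simp only [Finset.mem_range]
      omega

theorem D_succ (m : ℕ) :
    D (m + 1) = Polynomial.X * D m +
      ∑ w : Fin m → Bool, (Polynomial.X : Polynomial ℚ) ^ g (false :: List.ofFn w) := by
  unfold D
  rw [← (Fin.consEquiv fun _ : Fin (m + 1) => Bool).sum_comp, Fintype.sum_prod_type,
    Fintype.sum_bool, Finset.mul_sum]
  simp [Fin.consEquiv, List.ofFn_succ, g, pow_add]

/-- The recurrence `D_n(q) = q D_{n-1}(q) + q^n + ∑_{j=0}^{n-2} F_{n-1-j,j}(q)`,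
with `D_0(q) = 1`. -/
theorem stmt4 :
    D 0 = 1 ∧
    ∀ n : ℕ, 1 ≤ n →
      D n = Polynomial.X * D (n - 1) + Polynomial.X ^ n +
        ∑ j ∈ Finset.range (n - 1), F (n - 1 - j) j := by
  constructor
  · simp [D, g]
  · intro n hn
    obtain ⟨m, rfl⟩ : ∃ m, n = m + 1 := ⟨n - 1, by omega⟩
    rw [D_succ, sum_b, Nat.add_sub_cancel, add_assoc]
end

section
/- Let $n \ge 1$ and let $X_n$ count correct guesses after a one-time riffle shuffle and $C_{m_1,m_2}$ count correct guesses in the two-color card guessing game. Then for every integer $\ell \ge 0$: $\mathbb{P}(X_n = \ell) = \tfrac{1}{2}\,\mathbb{P}(X_{n-1} = \ell - 1) + \tfrac{1}{2^n}\,[\ell = n] + \tfrac{1}{2^n} \sum_{j=0}^{n-2} \binom{n-1}{j}\, \mathbb{P}(C_{n-1-j,\,j} = \ell)$. Equivalently, $X_n$ is distributed as the mixture $I_1 (X_{n-1}^* + 1) + (1 - I_1const)(I_2 \cdot n + (1-I_2)\, C_{n-1-J_n, J_n})$ with $I_1 \sim \mathrm{Be}(1/2)$, $I_2 \sim \mathrm{Be}(1/2^{n-1})$,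 and $J_n$ the truncated binomial with $\mathbb{P}(J_n = j) = \binom{n-1}{j}/(2^{n-1}-1)$ for $0 \le j \le n-2$, all independent. -/
/-- `P(X_n = ℓ)`, for `X_n = g(W)` with `W` uniform on `{a,b}^n`. -/
noncomputable def PX (n : ℕ) (ℓ : ℤ) : ℚ :=
  ((Finset.univ.filter fun w : Fin n → Bool => (g (List.ofFn w) : ℤ) = ℓ).card : ℚ) / 2 ^ n

/-- `P(C_{m₁,m₂} = ℓ)`, for `C_{m₁,m₂} = ĉ(W)` with `W` uniform on the words
with `m₁` `a`'s and `m₂` `b`'s. -/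
noncomputable def PC (m₁ m₂ : ℕ) (ℓ : ℤ) : ℚ :=
  (((wordsWith m₁ m₂).filter fun w => (chat (List.ofFn w) : ℤ) = ℓ).card : ℚ) /
    ((m₁ + m₂).choose m₁ : ℚ)

theorem sum_cons_split (m : ℕ) (F : List Bool → ℚ) :
    ∑ w : Fin (m + 1) → Bool, F (List.ofFn w) =
      ∑ w : Fin m → Bool, F (true :: List.ofFn w) +
        ∑ w : Fin m → Bool, F (false :: List.ofFn w) := by
  rw [← (Fin.consEquiv (fun _ : Fin (m + 1) => Bool)).sum_comp, Fintype.sum_prod_type,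
    Fintype.sum_bool]
  simp [Fin.consEquiv, List.ofFn_succ]

theorem choose_mul_PC (m k j : ℕ) (h : k + j = m) (l : ℤ) :
    (m.choose j : ℚ) * PC k j l =
      ∑ w : Fin m → Bool,
        if (List.ofFn w).count true = k ∧ (chat (List.ofFn w) : ℤ) = l then (1 : ℚ) else 0 := by
  subst h
  have h1 : (k + j).choose j = (k + j).choose k := (Nat.choose_symm_add).symm
  have h2 : ((k + j).choose k : ℚ) ≠ 0 := by
    exact_mod_cast (Nat.choose_pos (Nat.le_add_right k j)).ne'
  rw [PC, h1, mul_div_cancel₀ _ h2, wordsWith, Finset.filter_filter, Finset.sum_boole]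

theorem pointwise_false (m : ℕ) (l : ℤ) (w : Fin m → Bool) :
    (if (g (false :: List.ofFn w) : ℤ) = l then (1 : ℚ) else 0) =
      (if w = (fun _ => false) then (if l = ((m + 1 : ℕ) : ℤ) then (1 : ℚ) else 0) else 0) +
      ∑ j ∈ Finset.range m,
        if (List.ofFn w).count true = m - j ∧ (chat (List.ofFn w) : ℤ) = l
          then (1 : ℚ) else 0 := by
  by_cases hw : w = fun _ => false
  · subst hw
    have h0 : List.ofFn (fun _ : Fin m => false) = List.replicate m false := by simp
    rw [h0, Finset.sum_eq_zero]
    · simp [g, eq_comm]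
    · intro j hj
      have := Finset.mem_range.mp hj
      rw [if_neg]
      rintro ⟨h, -⟩
      simp [List.count_replicate] at h
      omega
  · have hne : ¬ List.ofFn w = List.replicate (List.ofFn w).length false := by
      intro h
      apply hw
      funext i
      exact List.eq_of_mem_replicate (h ▸ (List.mem_ofFn.mpr ⟨i, rfl⟩))
    have hpos : 0 < (List.ofFn w).count true := by
      by_contra hc
      apply hne
      rw [List.eq_replicate_iff]
      refine ⟨rfl, fun b hb => ?_⟩
      cases b
      · rfl
      · exact absurd (List.count_pos_iff.mpr hb) hc
    have hle : (List.ofFn w).count true ≤ m := by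
      simpa using List.count_le_length (a := true) (l := List.ofFn w)
    rw [if_neg hw, zero_add, g, if_neg hne,
      Finset.sum_eq_single (m - (List.ofFn w).count true)]
    · have : (List.ofFn w).count true = m - (m - (List.ofFn w).count true) := by omega
      simp only [← this, true_and]
    · intro j hj hj2
      have := Finset.mem_range.mp hj
      rw [if_neg]
      rintro ⟨h, -⟩
      omega
    · intro h
      exact absurd (Finset.mem_range.mpr (by omega)) h

/-- `P(X_n = ℓ) = (1/2) P(X_{n-1} = ℓ-1) + 2^{-n} [ℓ = n]
  + 2^{-n} ∑_{j=0}^{n-2} C(n-1,j) P(C_{n-1-j,j} = ℓ)`,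
i.e. `X_n` is the stated mixture of `X_{n-1}+1`, the constant `n`,
and `C_{n-1-J_n, J_n}` with `J_n` truncated binomial. -/
theorem stmt5 (n : ℕ) (hn : 1 ≤ n) (ℓ : ℤ) (hℓ : 0 ≤ ℓ) :
    PX n ℓ = 1 / 2 * PX (n - 1) (ℓ - 1) + (if ℓ = (n : ℤ) then (1 : ℚ) / 2 ^ n else 0) +
      1 / 2 ^ n * ∑ j ∈ Finset.range (n - 1), ((n - 1).choose j : ℚ) * PC (n - 1 - j) j ℓ := by
  obtain ⟨m, rfl⟩ : ∃ m, n = m + 1 := ⟨n - 1, by omega⟩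
  simp only [Nat.add_sub_cancel]
  have hsum : ∑ j ∈ Finset.range m, (m.choose j : ℚ) * PC (m - j) j ℓ =
      ∑ w : Fin m → Bool, ∑ j ∈ Finset.range m,
        if (List.ofFn w).count true = m - j ∧ (chat (List.ofFn w) : ℤ) = ℓ
          then (1 : ℚ) else 0 := by
    rw [Finset.sum_comm]
    refine Finset.sum_congr rfl fun j hj => ?_
    have := Finset.mem_range.mp hj
    exact choose_mul_PC m (m - j) j (by omega) ℓ
  rw [hsum, PX, PX, ← Finset.sum_boole, ← Finset.sum_boole,
    sum_cons_split m (fun v => if (g v : ℤ) = ℓ then (1 : ℚ) else 0)]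
  simp only [pointwise_false]
  rw [Finset.sum_add_distrib, Finset.sum_ite_eq' Finset.univ, if_pos (Finset.mem_univ _)]
  have ht : ∀ w : Fin m → Bool, ((g (true :: List.ofFn w) : ℤ) = ℓ) =
      ((g (List.ofFn w) : ℤ) = ℓ - 1) := by
    intro w
    rw [g]
    push_cast
    exact propext ⟨fun h => by omega, fun h => by omega⟩
  simp only [ht]
  split_ifs <;> field_simp <;> ring
end

section
/- The number of correct guesses after a one-time riffle shuffle satisfies the limit law: for every real $x > 0$, $\lim_{n \to \infty} \mathbb{P}\big(X_n \le \tfrac{n}{2} + x\sqrt{n}\big) = \int_0^x \sqrt{2/\pi}\; 8 t^2 e^{-2t^2}\, dt$. That is, $Y_n = (X_n - n/2)/\sqrt{n}$ converges in distribution to the generalized Gamma (Maxwell–Boltzmann) random variable $G$ with density $f(x) = \sqrt{2/\pi}\, 8x^2 e^{-2x^2}$ for $x \ge 0$. -/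
/-- `P(X_n ≤ t) = 2^{-n} #{w ∈ {a,b}^n : g(w) ≤ t}`. -/
noncomputable def PXle (n : ℕ) (t : ℝ) : ℝ :=
  ((Finset.univ.filter fun w : Fin n → Bool => (g (List.ofFn w) : ℝ) ≤ t).card : ℝ) / 2 ^ n
set_option linter.unusedSimpArgs false

open Filter Topology

open Classical in
/-- Number of words of length `n` with property `P`. -/
noncomputable def cnt (n : ℕ) (P : List Bool → Prop) : ℕ :=
  (Finset.univ.filter fun w : Fin n → Bool => P (List.ofFn w)).card

lemma cnt_congr {n : ℕ} {P Q : List Bool → Prop} (h : ∀ w, w.length = n → (P w ↔ Q w)) :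
    cnt n P = cnt n Q := by
  classical
  unfold cnt
  congr 1
  apply Finset.filter_congr
  intro w _
  exact h _ (by simp)

lemma cnt_mono {n : ℕ} {P Q : List Bool → Prop} (h : ∀ w, w.length = n → P w → Q w) :
    cnt n P ≤ cnt n Q := by
  unfold cnt
  apply Finset.card_le_card
  intro w hw
  simp only [Finset.mem_filter, Finset.mem_univ, true_and] at hw ⊢
  exact h _ (by simp) hw

lemma cnt_succ (n : ℕ) (P : List Bool → Prop) :
    cnt (n + 1) P = cnt n (fun w => P (true :: w)) + cnt n (fun w => P (false :: w)) := by
  classical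
  unfold cnt
  rw [Finset.card_filter, Finset.card_filter, Finset.card_filter,
    ← (Fin.consEquiv (fun _ : Fin (n + 1) => Bool)).sum_comp, Fintype.sum_prod_type]
  simp [Fin.consEquiv, List.ofFn_succ]

lemma cnt_zero_of {n : ℕ} {P : List Bool → Prop} (h : ∀ w, w.length = n → ¬ P w) :
    cnt n P = 0 := by
  classical
  unfold cnt
  rw [Finset.card_eq_zero, Finset.filter_eq_empty_iff]
  intro w _
  exact h _ (by simp)

lemma cnt_le (n : ℕ) (P : List Bool → Prop) : cnt n P ≤ 2 ^ n := by
  classical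
  unfold cnt
  refine (Finset.card_le_univ _).trans ?_
  simp

lemma cnt_or_le (n : ℕ) (P Q : List Bool → Prop) :
    cnt n (fun w => P w ∨ Q w) ≤ cnt n P + cnt n Q := by
  classical
  unfold cnt
  refine le_trans (le_of_eq ?_) (Finset.card_union_le _ _)
  rw [← Finset.filter_or]
  congr 1
  ext w
  simp

lemma cnt_fiber {n : ℕ} (P : List Bool → Prop) (f : List Bool → ℕ) (s : Finset ℕ)
    (h : ∀ w, w.length = n → P w → f w ∈ s) :
    cnt n P = ∑ i ∈ s, cnt n (fun w => f w = i ∧ P w) := by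
  classical
  unfold cnt
  rw [Finset.card_eq_sum_card_fiberwise (f := fun w : Fin n → Bool => f (List.ofFn w)) (t := s)]
  · apply Finset.sum_congr rfl
    intro i _
    congr 1
    ext w
    simp [and_comm]
  · intro w hw
    simp only [Finset.coe_filter, Finset.mem_univ, true_and, Set.mem_ofPred_eq] at hw
    exact h _ (by simp) hw

lemma count_tf (w : List Bool) : w.count true + w.count false = w.length := by
  induction w with
  | nil => simp
  | cons x w ih => cases x <;> simp <;> omega

lemma joint_step_true (n i c : ℕ) :
    cnt n (fun w => (true :: w).count true = i ∧ chat (true :: w) = c) =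
      if i = 0 then 0 else if n + 1 ≤ 2 * i then
        (if c = 0 then 0 else cnt n (fun w => w.count true = i - 1 ∧ chat w = c - 1))
      else cnt n (fun w => w.count true = i - 1 ∧ chat w = c) := by
  split_ifs with h1 h2 h3
  · apply cnt_zero_of
    intro w hw
    simp; omega
  · apply cnt_zero_of
    intro w hw
    have := count_tf w
    simp only [chat, List.count_cons]
    simp only [decide_eq_true_eq, decide_eq_false_iff_not, beq_self_eq_true, if_true, beq_iff_eq,
      reduceCtorEq, if_false]
    split_ifs <;> omega
  all_goals
    apply cnt_congr
    intro w hw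
    have := count_tf w
    simp only [chat, List.count_cons]
    simp only [decide_eq_true_eq, beq_self_eq_true, if_true, beq_iff_eq, reduceCtorEq, if_false]
    split_ifs <;> omega

lemma joint_step_false (n i c : ℕ) :
    cnt n (fun w => (false :: w).count true = i ∧ chat (false :: w) = c) =
      if n + 1 ≤ 2 * i then cnt n (fun w => w.count true = i ∧ chat w = c)
      else if c = 0 then 0 else cnt n (fun w => w.count true = i ∧ chat w = c - 1) := by
  split_ifs with h1 h2
  · apply cnt_congr
    intro w hw
    have := count_tf w
    simp only [chat, List.count_cons]
    simp only [decide_eq_false_iff_not, beq_self_eq_true, if_true, beq_iff_eq, reduceCtorEq, if_false]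
    split_ifs <;> omega
  · apply cnt_zero_of
    intro w hw
    have := count_tf w
    simp only [chat, List.count_cons]
    simp only [decide_eq_true_eq, decide_eq_false_iff_not, beq_self_eq_true, if_true, beq_iff_eq,
      reduceCtorEq, if_false]
    split_ifs <;> omega
  · apply cnt_congr
    intro w hw
    have := count_tf w
    simp only [chat, List.count_cons]
    simp only [decide_eq_false_iff_not, beq_self_eq_true, if_true, beq_iff_eq, reduceCtorEq, if_false]
    split_ifs <;> omega

/-- The joint law: uniform over the admissible letter counts, given the correct count. -/
lemma joint (n : ℕ) : ∀ i c : ℕ,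
    (cnt n (fun w => w.count true = i ∧ chat w = c) : ℤ) =
      if n ≤ i + c ∧ i ≤ c then (n.choose c : ℤ) - n.choose (c + 1) else 0 := by
  induction n with
  | zero =>
    intro i c
    have : cnt 0 (fun w => w.count true = i ∧ chat w = c) = if i = 0 ∧ c = 0 then 1 else 0 := by
      simp [cnt, chat, Finset.filter_const, eq_comm]
      split_ifs <;> simp
    rw [this]
    rcases c with _ | c
    · simp
    · simp
  | succ n ih =>
    intro i c
    rw [cnt_succ, joint_step_true, joint_step_false]
    rcases c with _ | c
    · rcases i with _ | i
      · simp
      · simp [ih]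
        omega
    · have e1 : ((n + 1).choose (c + 1) : ℤ) = n.choose c + n.choose (c + 1) := by
        rw [Nat.choose_succ_succ]; push_cast; ring
      have e2 : ((n + 1).choose (c + 1 + 1) : ℤ) = n.choose (c + 1) + n.choose (c + 1 + 1) := by
        rw [Nat.choose_succ_succ]; push_cast; ring
      rw [e1, e2]
      have key : n + 1 = 2 * (c + 1) → (n.choose c : ℤ) = n.choose (c + 1) := by
        intro h
        rw [show n = c + (c + 1) by omega, Nat.choose_symm_add]
      rcases i with _ | i
      · simp only [if_true, show ¬ (n + 1 ≤ 2 * 0) by omega, if_false, Nat.add_sub_cancel,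
          Nat.succ_ne_zero, Nat.cast_add, ih, Nat.cast_zero]
        split_ifs with h1 h2 h2 <;> try omega
        rw [Nat.choose_eq_zero_of_lt (show n < c + 1 by omega),
          Nat.choose_eq_zero_of_lt (show n < c + 1 + 1 by omega)]
        simp
      · simp only [Nat.succ_ne_zero, if_false, Nat.add_sub_cancel]
        by_cases h : n + 1 ≤ 2 * (i + 1)
        · simp only [h, if_true, Nat.cast_add, ih]
          split_ifs <;> try omega
        · simp only [h, if_false, Nat.cast_add, ih]
          split_ifs <;> try omega

lemma choose_mul_sub (n c : ℕ) :
    ((n : ℝ) + 1) * ((n.choose c : ℝ) - n.choose (c + 1)) =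
      (2 * c - n + 1) * (n + 1).choose (c + 1) := by
  have h1 : ((n : ℝ) + 1) * n.choose c = (n + 1).choose (c + 1) * (c + 1) := by
    exact_mod_cast Nat.add_one_mul_choose_eq n c
  have h2 : ((n + 1).choose (c + 1) : ℝ) = n.choose c + n.choose (c + 1) := by
    rw [Nat.choose_succ_succ]; push_cast; ring
  have h3 : (n.choose (c + 1) : ℝ) = (n + 1).choose (c + 1) - n.choose c := by linarith
  rw [h3]
  linear_combination 2 * h1

/-- The law of the majority-guessing count. -/
lemma cnt_chat (n c : ℕ) :
    (cnt n (fun w => chat w = c) : ℝ) =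
      if n ≤ 2 * c then (2 * (c : ℝ) - n + 1) ^ 2 / (n + 1) * (n + 1).choose (c + 1) else 0 := by
  rw [cnt_fiber (fun w => chat w = c) (fun w => w.count true) (Finset.range (n + 1))
    (by intro w hw _; have := count_tf w; simp; omega)]
  have hj : ∀ i, (cnt n (fun w => w.count true = i ∧ chat w = c) : ℝ) =
      if n ≤ i + c ∧ i ≤ c then (n.choose c : ℝ) - n.choose (c + 1) else 0 := by
    intro i
    have := joint n i c
    have h2 : ((cnt n (fun w => w.count true = i ∧ chat w = c) : ℤ) : ℝ) =
      ((if n ≤ i + c ∧ i ≤ c then (n.choose c : ℤ) - n.choose (c + 1) else 0 : ℤ) : ℝ) := by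
      rw [this]
    push_cast at h2
    exact h2
  push_cast
  simp_rw [hj]
  rw [← Finset.sum_filter, Finset.sum_const]
  have hn : (n : ℝ) + 1 ≠ 0 := by positivity
  rcases lt_or_ge n c with hc | hc
  · rw [Nat.choose_eq_zero_of_lt (show n < c by omega),
      Nat.choose_eq_zero_of_lt (show n < c + 1 by omega),
      Nat.choose_eq_zero_of_lt (show n + 1 < c + 1 by omega)]
    simp
  · have : (Finset.range (n + 1)).filter (fun i => n ≤ i + c ∧ i ≤ c) = Finset.Icc (n - c) c := by
      ext i; simp; omega
    rw [this, Nat.card_Icc]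
    split_ifs with h
    · rw [nsmul_eq_mul, Nat.cast_sub (by omega), Nat.cast_sub (by omega)]
      push_cast
      have := choose_mul_sub n c
      field_simp
      linear_combination (2 * (c:ℝ) - n + 1) * this
    · rw [show c + 1 - (n - c) = 0 by omega]
      simp

/-- The entropy estimate. -/
lemma entropy_bound {u : ℝ} (hu : |u| ≤ 1 / 2) :
    |(1 + u) * Real.log (1 + u) + (1 - u) * Real.log (1 - u) - u ^ 2| ≤ 6 * |u| ^ 3 := by
  have h1 := Real.abs_log_sub_add_sum_range_le (x := u) (by linarith) 2
  have h2 := Real.abs_log_sub_add_sum_range_le (x := -u) (by rw [abs_neg]; linarith) 2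
  rw [abs_neg] at h2
  simp only [Finset.sum_range_succ, Finset.sum_range_zero] at h1 h2
  norm_num at h1 h2
  have hb : |u| ^ 3 / (1 - |u|) ≤ 2 * |u| ^ 3 := by
    rw [div_le_iff₀ (by linarith)]
    nlinarith [pow_nonneg (abs_nonneg u) 3]
  set e1 := u + u ^ 2 / 2 + Real.log (1 - u) with he1
  set e2 := -u + u ^ 2 / 2 + Real.log (1 + u) with he2
  have hl1 : Real.log (1 - u) = e1 - u - u ^ 2 / 2 := by rw [he1]; ring
  have hl2 : Real.log (1 + u) = e2 + u - u ^ 2 / 2 := by rw [he2]; ring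
  rw [hl1, hl2]
  have : (1 + u) * (e2 + u - u ^ 2 / 2) + (1 - u) * (e1 - u - u ^ 2 / 2) - u ^ 2 =
    (1 + u) * e2 + (1 - u) * e1 := by ring
  rw [this]
  have ha := abs_le.1 hu
  have hp := pow_nonneg (abs_nonneg u) 3
  calc |(1 + u) * e2 + (1 - u) * e1| ≤ |(1 + u) * e2| + |(1 - u) * e1| := abs_add_le _ _
    _ = (1 + u) * |e2| + (1 - u) * |e1| := by
      rw [abs_mul, abs_mul, abs_of_nonneg (by linarith : 0 ≤ 1 + u),
        abs_of_nonneg (by linarith : 0 ≤ 1 - u)]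
    _ ≤ (1 + u) * (2 * |u| ^ 3) + (1 - u) * (2 * |u| ^ 3) := by
      gcongr
      · linarith
      · linarith
      · linarith
      · linarith
    _ ≤ 6 * |u| ^ 3 := by nlinarith

/-- Exact Stirling factorisation of a binomial coefficient. -/
lemma choose_stirling {n k : ℕ} (hk : 0 < k) (hkn : k < n) :
    Real.sqrt n * (n.choose k : ℝ) / 2 ^ n =
      Stirling.stirlingSeq n / (Stirling.stirlingSeq k * Stirling.stirlingSeq (n - k)) *
      (1 / Real.sqrt (2 * ((k : ℝ) / n) * ((n - k : ℕ) / n))) *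
      Real.exp (-((n : ℝ) / 2 * ((1 + (2 * (k : ℝ) / n - 1)) * Real.log (1 + (2 * (k : ℝ) / n - 1)) +
        (1 - (2 * (k : ℝ) / n - 1)) * Real.log (1 - (2 * (k : ℝ) / n - 1))))) := by
  obtain ⟨m, rfl⟩ := Nat.exists_eq_add_of_lt hkn
  rw [show k + m + 1 - k = m + 1 by omega]
  have hn' : 0 < k + m + 1 := by omega
  have hm' : 0 < m + 1 := by omega
  generalize hm : m + 1 = l at *
  generalize hn : k + m + 1 = n at *
  have hnl : n = k + l := by omega
  have hnr : (n : ℝ) = k + l := by rw [hnl]; push_cast; ring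
  have hN : (0 : ℝ) < n := by exact_mod_cast hn'
  have hK : (0 : ℝ) < k := by exact_mod_cast hk
  have hL : (0 : ℝ) < l := by exact_mod_cast hm'
  have e1 : 1 + (2 * (k : ℝ) / n - 1) = 2 * k / n := by ring
  have e2 : 1 - (2 * (k : ℝ) / n - 1) = 2 * l / n := by
    field_simp
    rw [hnr]; ring
  rw [e1, e2]
  have e3 : Real.exp (-((n : ℝ) / 2 * (2 * k / n * Real.log (2 * k / n) +
      2 * l / n * Real.log (2 * l / n)))) = 1 / ((2 * (k : ℝ) / n) ^ k * (2 * (l : ℝ) / n) ^ l) := by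
    have : -((n : ℝ) / 2 * (2 * k / n * Real.log (2 * k / n) +
      2 * l / n * Real.log (2 * l / n))) =
      -(k * Real.log (2 * k / n) + l * Real.log (2 * l / n)) := by field_simp
    rw [this, Real.exp_neg, Real.exp_add, ← Real.log_pow, ← Real.log_pow, Real.exp_log (by positivity),
      Real.exp_log (by positivity), one_div]
  rw [e3]
  have hch : (n.choose k : ℝ) = (n.factorial : ℝ) / (k.factorial * l.factorial) := by
    rw [hnl, Nat.choose_symm_add, Nat.add_choose, Nat.cast_div (Nat.factorial_mul_factorial_dvd_factorial_add k l)
      (by positivity)]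
    push_cast; rfl
  rw [hch]
  unfold Stirling.stirlingSeq
  have hs : Real.sqrt (2 * ((k : ℝ) / n) * (l / n)) =
      Real.sqrt (2 * k) * Real.sqrt (2 * l) / (Real.sqrt n * Real.sqrt (2 * n)) := by
    rw [← Real.sqrt_mul (by positivity), ← Real.sqrt_mul (by positivity),
      ← Real.sqrt_div (by positivity)]
    congr 1
    field_simp
  rw [hs]
  have p1 : Real.sqrt (2 * (k : ℝ)) ≠ 0 := by positivity
  have p2 : Real.sqrt (2 * (l : ℝ)) ≠ 0 := by positivity
  have p3 : Real.sqrt (2 * (n : ℝ)) ≠ 0 := by positivity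
  have p4 : Real.sqrt (n : ℝ) ≠ 0 := by positivity
  have p5 : (k.factorial : ℝ) ≠ 0 := by positivity
  have p6 : (l.factorial : ℝ) ≠ 0 := by positivity
  have p7 : (n.factorial : ℝ) ≠ 0 := by positivity
  have p8 := (Real.exp_pos 1).ne'
  have hpn : ∀ y : ℝ, y ^ n = y ^ k * y ^ l := by intro y; rw [hnl, pow_add]
  simp only [div_pow, mul_pow, hpn]
  generalize Real.sqrt (2 * (k : ℝ)) = a1 at *
  generalize Real.sqrt (2 * (l : ℝ)) = a2 at *
  generalize Real.sqrt (2 * (n : ℝ)) = a3 at *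
  generalize Real.sqrt (n : ℝ) = a4 at *
  field_simp

/-- Local central limit theorem for the symmetric binomial distribution. -/
lemma local_clt (k : ℕ → ℕ) (c : ℝ)
    (h : Tendsto (fun n : ℕ => ((k n : ℝ) - n / 2) / Real.sqrt n) atTop (𝓝 c)) :
    Tendsto (fun n : ℕ => Real.sqrt n * (n.choose (k n) : ℝ) / 2 ^ n) atTop
      (𝓝 (Real.sqrt (2 / Real.pi) * Real.exp (-2 * c ^ 2))) := by
  have hsq : Tendsto (fun n : ℕ => Real.sqrt (n : ℝ)) atTop atTop :=
    Real.tendsto_sqrt_atTop.comp tendsto_natCast_atTop_atTop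
  set u : ℕ → ℝ := fun n => 2 * (k n : ℝ) / n - 1 with hu
  have hsu : Tendsto (fun n : ℕ => Real.sqrt n * u n) atTop (𝓝 (2 * c)) := by
    refine (h.const_mul 2).congr' ?_
    filter_upwards [eventually_gt_atTop 0] with n hn
    have hN : (0 : ℝ) < n := by exact_mod_cast hn
    have hs : Real.sqrt n ^ 2 = n := Real.sq_sqrt hN.le
    have hs0 : 0 < Real.sqrt n := Real.sqrt_pos.2 hN
    simp only [hu]
    generalize Real.sqrt (n : ℝ) = s at *
    rw [← hs]
    field_simp
  have hu0 : Tendsto u atTop (𝓝 0) := by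
    have := hsu.mul (tendsto_inv_atTop_zero.comp hsq)
    rw [mul_zero] at this
    refine this.congr' ?_
    filter_upwards [eventually_gt_atTop 0] with n hn
    have hN : (0 : ℝ) < n := by exact_mod_cast hn
    have hs0 : Real.sqrt n ≠ 0 := (Real.sqrt_pos.2 hN).ne'
    simp only [Function.comp]
    field_simp
  have hkn : Tendsto (fun n : ℕ => (k n : ℝ) / n) atTop (𝓝 (1 / 2)) := by
    have := (hu0.add_const 1).div_const 2
    simp only [hu] at this
    rw [zero_add] at this
    refine this.congr ?_
    intro n; ring
  have hev : ∀ᶠ n : ℕ in atTop, 0 < k n ∧ k n < n ∧ (n : ℝ) / 4 ≤ k n ∧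
      (n : ℝ) / 4 ≤ ((n - k n : ℕ) : ℝ) := by
    filter_upwards [eventually_gt_atTop 0, hkn.eventually (lt_mem_nhds (show (1/4 : ℝ) < 1 / 2 by norm_num)),
      hkn.eventually (gt_mem_nhds (show (1/2 : ℝ) < 3 / 4 by norm_num))] with n hn h1 h2
    have hN : (0 : ℝ) < n := by exact_mod_cast hn
    rw [lt_div_iff₀ hN] at h1
    rw [div_lt_iff₀ hN] at h2
    have a1 : (0 : ℝ) < k n := by linarith
    have a2 : (k n : ℝ) < n := by linarith
    have a3 : k n < n := by exact_mod_cast a2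
    refine ⟨by exact_mod_cast a1, a3, by linarith, ?_⟩
    rw [Nat.cast_sub a3.le]
    linarith
  have hk : Tendsto k atTop atTop := by
    rw [← tendsto_natCast_atTop_iff (R := ℝ)]
    refine tendsto_atTop_mono' _ (hev.mono fun n hn => hn.2.2.1) ?_
    exact tendsto_natCast_atTop_atTop.atTop_div_const (by norm_num)
  have hl : Tendsto (fun n => n - k n) atTop atTop := by
    rw [← tendsto_natCast_atTop_iff (R := ℝ)]
    refine tendsto_atTop_mono' _ (hev.mono fun n hn => hn.2.2.2) ?_
    exact tendsto_natCast_atTop_atTop.atTop_div_const (by norm_num)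
  have hst := Stirling.tendsto_stirlingSeq_sqrt_pi
  have hpi : Real.sqrt Real.pi ≠ 0 := by positivity
  have t1 : Tendsto (fun n => Stirling.stirlingSeq n /
      (Stirling.stirlingSeq (k n) * Stirling.stirlingSeq (n - k n))) atTop
      (𝓝 (Real.sqrt Real.pi / (Real.sqrt Real.pi * Real.sqrt Real.pi))) :=
    hst.div ((hst.comp hk).mul (hst.comp hl)) (by positivity)
  have hln : Tendsto (fun n : ℕ => ((n - k n : ℕ) : ℝ) / n) atTop (𝓝 (1 / 2)) := by
    have := hkn.const_sub 1
    rw [show (1 : ℝ) - 1 / 2 = 1 / 2 by norm_num] at this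
    refine this.congr' ?_
    filter_upwards [hev, eventually_gt_atTop 0] with n hn h0
    have hN : (0 : ℝ) < n := by exact_mod_cast h0
    rw [Nat.cast_sub hn.2.1.le]
    field_simp
  have t2 : Tendsto (fun n : ℕ => 1 / Real.sqrt (2 * ((k n : ℝ) / n) * ((n - k n : ℕ) / n))) atTop
      (𝓝 (1 / Real.sqrt (2 * (1 / 2) * (1 / 2)))) := by
    refine Tendsto.div tendsto_const_nhds ?_ (by positivity)
    exact (Real.continuous_sqrt.tendsto _).comp ((hkn.const_mul 2).mul hln)
  have t3 : Tendsto (fun n : ℕ => (n : ℝ) / 2 * ((1 + u n) * Real.log (1 + u n) +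
        (1 - u n) * Real.log (1 - u n))) atTop (𝓝 (2 * c ^ 2)) := by
    have a1 : Tendsto (fun n : ℕ => (n : ℝ) / 2 * u n ^ 2) atTop (𝓝 (2 * c ^ 2)) := by
      have := (hsu.pow 2).div_const 2
      rw [show (2 * c) ^ 2 / 2 = 2 * c ^ 2 by ring] at this
      refine this.congr ?_
      intro n
      rw [mul_pow, Real.sq_sqrt (by positivity)]
      ring
    have a2 : Tendsto (fun n : ℕ => (n : ℝ) / 2 * u n ^ 2 * (6 * |u n|)) atTop (𝓝 0) := by
      have := a1.mul (hu0.abs.const_mul 6)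
      simpa using this
    have a3 : Tendsto (fun n : ℕ => (n : ℝ) / 2 * ((1 + u n) * Real.log (1 + u n) +
        (1 - u n) * Real.log (1 - u n)) - (n : ℝ) / 2 * u n ^ 2) atTop (𝓝 0) := by
      refine squeeze_zero_norm' ?_ a2
      have : ∀ᶠ n in atTop, |u n| < 1 / 2 := by
        have := hu0.abs
        rw [abs_zero] at this
        exact this.eventually (gt_mem_nhds (by norm_num))
      filter_upwards [this] with n hn
      have hb := entropy_bound hn.le
      rw [← mul_sub, Real.norm_eq_abs, abs_mul, abs_of_nonneg (by positivity : (0 : ℝ) ≤ n / 2)]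
      calc _ ≤ (n : ℝ) / 2 * (6 * |u n| ^ 3) := by gcongr
        _ = _ := by rw [← sq_abs (u n)]; ring
    have := a3.add a1
    simpa using this
  have t4 := (Real.continuous_exp.tendsto _).comp t3.neg
  have t5 := (t1.mul t2).mul t4
  have hlim : Real.sqrt Real.pi / (Real.sqrt Real.pi * Real.sqrt Real.pi) *
      (1 / Real.sqrt (2 * (1 / 2) * (1 / 2))) * Real.exp (-(2 * c ^ 2)) =
      Real.sqrt (2 / Real.pi) * Real.exp (-2 * c ^ 2) := by
    rw [show -(2 * c ^ 2) = -2 * c ^ 2 by ring]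
    congr 1
    rw [Real.sqrt_div (by norm_num), show (2 : ℝ) * (1 / 2) * (1 / 2) = 1 / 2 by norm_num,
      Real.sqrt_div (by norm_num), Real.sqrt_one]
    field_simp
  rw [hlim] at t5
  refine t5.congr' ?_
  filter_upwards [hev] with n hn
  rw [choose_stirling hn.1 hn.2.1]
  rfl

lemma tendsto_div_sqrt_of_bounded {a : ℕ → ℝ} {u D : ℝ}
    (h : ∀ᶠ n : ℕ in atTop, |a n - u * Real.sqrt n| ≤ D) :
    Tendsto (fun n : ℕ => a n / Real.sqrt n) atTop (𝓝 u) := by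
  have hsq : Tendsto (fun n : ℕ => Real.sqrt (n : ℝ)) atTop atTop :=
    Real.tendsto_sqrt_atTop.comp tendsto_natCast_atTop_atTop
  have h0 : Tendsto (fun n : ℕ => D / Real.sqrt n) atTop (𝓝 0) := hsq.const_div_atTop D
  rw [tendsto_iff_norm_sub_tendsto_zero]
  refine squeeze_zero' (Eventually.of_forall fun n => norm_nonneg _) ?_ h0
  filter_upwards [h, eventually_gt_atTop 0] with n hn hn0
  have hN : (0 : ℝ) < n := by exact_mod_cast hn0
  have hs0 : 0 < Real.sqrt n := Real.sqrt_pos.2 hN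
  rw [Real.norm_eq_abs, show a n / Real.sqrt n - u = (a n - u * Real.sqrt n) / Real.sqrt n by
    field_simp, abs_div, abs_of_pos hs0]
  gcongr

/-- The integer at scaled position `u`. -/
noncomputable def kk (n : ℕ) (u : ℝ) : ℕ := (n + 1) / 2 + ⌊u * Real.sqrt n⌋₊

/-- The rescaled probability density. -/
noncomputable def qq (n : ℕ) (u : ℝ) : ℝ :=
  Real.sqrt n * ((cnt n (fun w => chat w = kk n u) : ℝ) / 2 ^ n)

lemma kk_bounds (n : ℕ) {u : ℝ} (hu : 0 ≤ u) :
    u * Real.sqrt (n + 1 : ℕ) - (u + 1) ≤ ((kk n u + 1 : ℕ) : ℝ) - ((n + 1 : ℕ) : ℝ) / 2 ∧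
      ((kk n u + 1 : ℕ) : ℝ) - ((n + 1 : ℕ) : ℝ) / 2 ≤ u * Real.sqrt (n + 1 : ℕ) + 1 ∧
      0 ≤ ((kk n u + 1 : ℕ) : ℝ) - ((n + 1 : ℕ) : ℝ) / 2 := by
  have h1 : ((n + 1 : ℕ) : ℝ) ≤ 2 * (((n + 1) / 2 : ℕ) : ℝ) + 1 := by
    exact_mod_cast (show n + 1 ≤ 2 * ((n + 1) / 2) + 1 by omega)
  have h2 : 2 * (((n + 1) / 2 : ℕ) : ℝ) ≤ ((n + 1 : ℕ) : ℝ) := by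
    exact_mod_cast (show 2 * ((n + 1) / 2) ≤ n + 1 by omega)
  have hy : 0 ≤ u * Real.sqrt n := by positivity
  have h3 := Nat.floor_le hy
  have h4 := Nat.lt_floor_add_one (u * Real.sqrt n)
  have h5 : Real.sqrt n ≤ Real.sqrt (n + 1 : ℕ) := Real.sqrt_le_sqrt (by push_cast; linarith)
  have h6 : Real.sqrt (n + 1 : ℕ) ≤ Real.sqrt n + 1 := by
    rw [Real.sqrt_le_left (by positivity)]
    have := Real.sq_sqrt (Nat.cast_nonneg (α := ℝ) n)
    push_cast
    nlinarith [Real.sqrt_nonneg (n : ℝ)]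
  have h7 : u * Real.sqrt n ≤ u * Real.sqrt (n + 1 : ℕ) := by gcongr
  have h8 : u * Real.sqrt (n + 1 : ℕ) ≤ u * (Real.sqrt n + 1) := by gcongr
  have h9 : ((kk n u + 1 : ℕ) : ℝ) = (((n + 1) / 2 : ℕ) : ℝ) + ⌊u * Real.sqrt n⌋₊ + 1 := by
    unfold kk; push_cast; rfl
  have h10 : (0 : ℝ) ≤ ⌊u * Real.sqrt n⌋₊ := Nat.cast_nonneg _
  rw [h9]
  refine ⟨by linarith, by linarith, by linarith⟩

lemma qq_eq (n : ℕ) (u : ℝ) : qq n u = Real.sqrt n / Real.sqrt (n + 1 : ℕ) * 8 *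
    ((((kk n u + 1 : ℕ) : ℝ) - ((n + 1 : ℕ) : ℝ) / 2) / Real.sqrt (n + 1 : ℕ)) ^ 2 *
    (Real.sqrt (n + 1 : ℕ) * ((n + 1).choose (kk n u + 1) : ℝ) / 2 ^ (n + 1)) := by
  unfold qq
  rw [cnt_chat, if_pos (by unfold kk; omega)]
  have hs : Real.sqrt (n + 1 : ℕ) ^ 2 = n + 1 := by rw [Real.sq_sqrt (by positivity)]; push_cast; ring
  have hs0 : Real.sqrt (n + 1 : ℕ) ≠ 0 := by positivity
  generalize Real.sqrt (n + 1 : ℕ) = s at *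
  rw [← hs, pow_succ]
  push_cast
  field_simp
  ring

lemma qq_tendsto {u : ℝ} (hu : 0 ≤ u) :
    Tendsto (fun n => qq n u) atTop
      (𝓝 (Real.sqrt (2 / Real.pi) * 8 * u ^ 2 * Real.exp (-2 * u ^ 2))) := by
  have a1 : Tendsto (fun m : ℕ => (((kk (m - 1) u + 1 : ℕ) : ℝ) - (m : ℝ) / 2) / Real.sqrt m)
      atTop (𝓝 u) := by
    apply tendsto_div_sqrt_of_bounded (D := u + 1)
    filter_upwards [eventually_gt_atTop 0] with m hm
    obtain ⟨n, rfl⟩ : ∃ n, m = n + 1 := ⟨m - 1, by omega⟩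
    have := kk_bounds n hu
    rw [Nat.add_sub_cancel, abs_le]
    constructor <;> linarith
  have a2 := (local_clt _ u a1).comp (tendsto_add_atTop_nat 1)
  have a3 := a1.comp (tendsto_add_atTop_nat 1)
  have a4 : Tendsto (fun n : ℕ => Real.sqrt n / Real.sqrt (n + 1 : ℕ)) atTop (𝓝 1) := by
    have := (Real.continuous_sqrt.tendsto _).comp (tendsto_natCast_div_add_atTop (1 : ℝ))
    rw [Real.sqrt_one] at this
    refine this.congr ?_
    intro n
    simp only [Function.comp]
    rw [Real.sqrt_div (by positivity)]
    push_cast; rfl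
  have a5 := ((a4.mul_const 8).mul (a3.pow 2)).mul a2
  rw [show Real.sqrt (2 / Real.pi) * 8 * u ^ 2 * Real.exp (-2 * u ^ 2) =
    1 * 8 * u ^ 2 * (Real.sqrt (2 / Real.pi) * Real.exp (-2 * u ^ 2)) by ring]
  refine a5.congr ?_
  intro n
  rw [qq_eq]
  rfl

lemma qq_nonneg (n : ℕ) (u : ℝ) : 0 ≤ qq n u := by unfold qq; positivity

lemma qq_bound : ∃ K : ℝ, 0 ≤ K ∧ ∀ n : ℕ, ∀ u : ℝ, 0 ≤ u → qq n u ≤ 8 * (u + 1) ^ 2 * K := by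
  have a1 : Tendsto (fun m : ℕ => (((m / 2 : ℕ) : ℝ) - (m : ℝ) / 2) / Real.sqrt m)
      atTop (𝓝 0) := by
    apply tendsto_div_sqrt_of_bounded (D := 1)
    refine Eventually.of_forall fun m => ?_
    have h1 : (m : ℝ) ≤ 2 * ((m / 2 : ℕ) : ℝ) + 1 := by
      exact_mod_cast (show m ≤ 2 * (m / 2) + 1 by omega)
    have h2 : 2 * ((m / 2 : ℕ) : ℝ) ≤ (m : ℝ) := by
      exact_mod_cast (show 2 * (m / 2) ≤ m by omega)
    rw [zero_mul, sub_zero, abs_le]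
    constructor <;> linarith
  obtain ⟨K, hK⟩ := (local_clt _ 0 a1).bddAbove_range
  have hK' : ∀ m : ℕ, Real.sqrt m * (m.choose (m / 2) : ℝ) / 2 ^ m ≤ K := fun m =>
    hK ⟨m, rfl⟩
  have hK0 : 0 ≤ K := le_trans (by positivity) (hK' 0)
  refine ⟨K, hK0, ?_⟩
  intro n u hu
  rw [qq_eq]
  have hs0 : 0 < Real.sqrt (n + 1 : ℕ) := by positivity
  have hs1 : 1 ≤ Real.sqrt (n + 1 : ℕ) := by
    rw [Real.one_le_sqrt]; push_cast; linarith [Nat.cast_nonneg (α := ℝ) n]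
  obtain ⟨-, b2, b3⟩ := kk_bounds n hu
  have c1 : Real.sqrt n / Real.sqrt (n + 1 : ℕ) ≤ 1 := by
    rw [div_le_one hs0]
    exact Real.sqrt_le_sqrt (by push_cast; linarith)
  have c2 : (((kk n u + 1 : ℕ) : ℝ) - ((n + 1 : ℕ) : ℝ) / 2) / Real.sqrt (n + 1 : ℕ) ≤ u + 1 := by
    rw [div_le_iff₀ hs0]
    linarith
  have c3 : 0 ≤ (((kk n u + 1 : ℕ) : ℝ) - ((n + 1 : ℕ) : ℝ) / 2) / Real.sqrt (n + 1 : ℕ) := by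
    positivity
  have c4 : Real.sqrt (n + 1 : ℕ) * ((n + 1).choose (kk n u + 1) : ℝ) / 2 ^ (n + 1) ≤ K := by
    refine le_trans ?_ (hK' (n + 1))
    gcongr
    exact Nat.choose_le_middle _ _
  calc _ ≤ 1 * 8 * (u + 1) ^ 2 * K := by gcongr
    _ = _ := by ring

lemma qq_measurable (n : ℕ) : Measurable (qq n) := by
  have : qq n = (fun j : ℕ => Real.sqrt n *
      ((cnt n (fun w => chat w = (n + 1) / 2 + j) : ℝ) / 2 ^ n)) ∘
      (fun u : ℝ => ⌊u * Real.sqrt n⌋₊) := rfl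
  rw [this]
  exact measurable_from_nat.comp (Nat.measurable_floor.comp (measurable_id.mul_const _))

lemma step_integral (a : ℕ → ℝ) (N : ℕ) :
    ∑ j ∈ Finset.range N, a j = ∫ v in (0 : ℝ)..N, a ⌊v⌋₊ := by
  have hfl : ∀ k : ℕ, Set.EqOn (fun _ : ℝ => a k) (fun v : ℝ => a ⌊v⌋₊)
      (Set.Ioo (k : ℝ) ((k + 1 : ℕ) : ℝ)) := by
    intro k v hv
    have : ⌊v⌋₊ = k := by
      rw [Nat.floor_eq_iff (le_trans (Nat.cast_nonneg k) hv.1.le)]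
      refine ⟨hv.1.le, ?_⟩
      have := hv.2
      push_cast at this
      exact this
    simp [this]
  have hle : ∀ k : ℕ, (k : ℝ) ≤ ((k + 1 : ℕ) : ℝ) := fun k => by push_cast; linarith
  have h := intervalIntegral.sum_integral_adjacent_intervals (f := fun v : ℝ => a ⌊v⌋₊)
    (μ := MeasureTheory.volume) (a := fun k : ℕ => (k : ℝ)) (n := N) (by
      intro k _
      rw [intervalIntegrable_iff_integrableOn_Ioo_of_le (hle k)]
      exact MeasureTheory.IntegrableOn.congr_fun
        (MeasureTheory.integrableOn_const (by simp)) (hfl k) measurableSet_Ioo)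
  simp only [Nat.cast_zero] at h
  rw [← h]
  apply Finset.sum_congr rfl
  intro k _
  rw [intervalIntegral.integral_of_le (hle k), MeasureTheory.integral_Ioc_eq_integral_Ioo,
    ← MeasureTheory.setIntegral_congr_fun measurableSet_Ioo (hfl k)]
  simp

lemma sum_eq_qq (n N : ℕ) (hn : 0 < n) :
    ∑ j ∈ Finset.range N, (cnt n (fun w => chat w = (n + 1) / 2 + j) : ℝ) / 2 ^ n =
      ∫ u in (0 : ℝ)..(N / Real.sqrt n), qq n u := by
  have hs0 : 0 < Real.sqrt n := Real.sqrt_pos.2 (by exact_mod_cast hn)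
  rw [step_integral (fun j => (cnt n (fun w => chat w = (n + 1) / 2 + j) : ℝ) / 2 ^ n)]
  have := intervalIntegral.mul_integral_comp_mul_right (a := 0) (b := N / Real.sqrt n)
    (f := fun v : ℝ => (cnt n (fun w => chat w = (n + 1) / 2 + ⌊v⌋₊) : ℝ) / 2 ^ n) (Real.sqrt n)
  rw [zero_mul, div_mul_cancel₀ _ hs0.ne'] at this
  rw [← this, ← intervalIntegral.integral_const_mul]
  rfl

lemma cdf_eq (n : ℕ) (t : ℝ) (ht : 0 ≤ t) (h : (n + 1) / 2 ≤ ⌊t⌋₊ + 1) :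
    (cnt n (fun w => (chat w : ℝ) ≤ t) : ℝ) / 2 ^ n =
      ∑ j ∈ Finset.range (⌊t⌋₊ + 1 - (n + 1) / 2),
        (cnt n (fun w => chat w = (n + 1) / 2 + j) : ℝ) / 2 ^ n := by
  rw [cnt_fiber (fun w => (chat w : ℝ) ≤ t) chat (Finset.range (⌊t⌋₊ + 1))
    (by intro w _ hw; have := (Nat.le_floor_iff ht).2 hw; simp; omega)]
  rw [← Finset.sum_div]
  congr 1
  have h1 : ∀ i ∈ Finset.range (⌊t⌋₊ + 1), cnt n (fun w => chat w = i ∧ (chat w : ℝ) ≤ t) =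
      cnt n (fun w => chat w = i) := by
    intro i hi
    apply cnt_congr
    intro w _
    constructor
    · exact fun h => h.1
    · rintro rfl
      refine ⟨rfl, ?_⟩
      rw [← Nat.le_floor_iff ht]
      simp at hi; omega
  rw [Finset.sum_congr rfl h1]
  push_cast
  conv_lhs => rw [show ⌊t⌋₊ + 1 = (n + 1) / 2 + (⌊t⌋₊ + 1 - (n + 1) / 2) by omega]
  rw [Finset.sum_range_add]
  rw [Finset.sum_eq_zero, zero_add]
  intro i hi
  rw [cnt_chat, if_neg]
  simp at hi; omega

/-- Limit law for the majority-guessing count, along perturbed thresholds. -/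
lemma chat_limit (x : ℝ) (hx : 0 < x) (T : ℕ → ℝ)
    (hT : Tendsto (fun n : ℕ => (T n - n / 2) / Real.sqrt n) atTop (𝓝 x)) :
    Tendsto (fun n : ℕ => (cnt n (fun w => (chat w : ℝ) ≤ T n) : ℝ) / 2 ^ n) atTop
      (𝓝 (∫ t in (0:ℝ)..x,
        Real.sqrt (2 / Real.pi) * 8 * t ^ 2 * Real.exp (-2 * t ^ 2))) := by
  have hsq : Tendsto (fun n : ℕ => Real.sqrt (n : ℝ)) atTop atTop :=
    Real.tendsto_sqrt_atTop.comp tendsto_natCast_atTop_atTop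
  set N : ℕ → ℕ := fun n => ⌊T n⌋₊ + 1 - (n + 1) / 2 with hN
  have hpos : ∀ᶠ n : ℕ in atTop, (n : ℝ) / 2 ≤ T n := by
    filter_upwards [hT.eventually (lt_mem_nhds hx), eventually_gt_atTop 0] with n h1 h2
    have hs0 : 0 < Real.sqrt n := Real.sqrt_pos.2 (by exact_mod_cast h2)
    rw [lt_div_iff₀ hs0] at h1
    linarith
  have hN1 : ∀ᶠ n : ℕ in atTop, 0 ≤ T n ∧ (n + 1) / 2 ≤ ⌊T n⌋₊ + 1 ∧
      |(N n : ℝ) - (T n - n / 2)| ≤ 2 := by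
    filter_upwards [hpos] with n h1
    have h0 : 0 ≤ T n := le_trans (by positivity) h1
    have f1 := Nat.floor_le h0
    have f2 := Nat.lt_floor_add_one (T n)
    have g1 : ((n + 1 : ℕ) : ℝ) ≤ 2 * (((n + 1) / 2 : ℕ) : ℝ) + 1 := by
      exact_mod_cast (show n + 1 ≤ 2 * ((n + 1) / 2) + 1 by omega)
    have g2 : 2 * (((n + 1) / 2 : ℕ) : ℝ) ≤ ((n + 1 : ℕ) : ℝ) := by
      exact_mod_cast (show 2 * ((n + 1) / 2) ≤ n + 1 by omega)
    push_cast at g1 g2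
    have h3 : (n + 1) / 2 ≤ ⌊T n⌋₊ + 1 := by
      have : ((n : ℕ) : ℝ) < ((2 * (⌊T n⌋₊ + 1) : ℕ) : ℝ) := by push_cast; linarith
      have := Nat.cast_lt.1 this
      omega
    refine ⟨h0, h3, ?_⟩
    simp only [hN]
    rw [Nat.cast_sub h3, abs_le]
    push_cast
    constructor <;> linarith
  have hX : Tendsto (fun n : ℕ => (N n : ℝ) / Real.sqrt n) atTop (𝓝 x) := by
    have : Tendsto (fun n : ℕ => ((N n : ℝ) - (T n - n / 2)) / Real.sqrt n) atTop (𝓝 0) := by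
      apply tendsto_div_sqrt_of_bounded (D := 2)
      filter_upwards [hN1] with n hn
      rw [zero_mul, sub_zero]
      exact hn.2.2
    have := this.add hT
    rw [zero_add] at this
    refine this.congr ?_
    intro n
    ring
  set f : ℝ → ℝ := fun t => Real.sqrt (2 / Real.pi) * 8 * t ^ 2 * Real.exp (-2 * t ^ 2) with hf
  obtain ⟨K, hK0, hK⟩ := qq_bound
  have main : Tendsto (fun n : ℕ => ∫ u, (Set.Ioc 0 ((N n : ℝ) / Real.sqrt n)).indicator (qq n) u)
      atTop (𝓝 (∫ u, (Set.Ioc 0 x).indicator f u)) := by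
    apply MeasureTheory.tendsto_integral_filter_of_dominated_convergence
      ((Set.Ioc 0 (x + 1)).indicator (fun _ => 8 * (x + 1 + 1) ^ 2 * K))
    · refine Eventually.of_forall fun n => ?_
      exact ((qq_measurable n).indicator measurableSet_Ioc).aestronglyMeasurable
    · filter_upwards [hX.eventually (gt_mem_nhds (show x < x + 1 by linarith))] with n hn
      refine Eventually.of_forall fun u => ?_
      by_cases hu : u ∈ Set.Ioc 0 ((N n : ℝ) / Real.sqrt n)
      · have hu2 : u ∈ Set.Ioc 0 (x + 1) := ⟨hu.1, hu.2.trans hn.le⟩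
        rw [Set.indicator_of_mem hu, Set.indicator_of_mem hu2, Real.norm_of_nonneg (qq_nonneg n u)]
        refine (hK n u hu.1.le).trans ?_
        have := hu2.1
        have := hu2.2
        gcongr
      · rw [Set.indicator_of_notMem hu, norm_zero]
        apply Set.indicator_nonneg
        intro _ _
        positivity
    · rw [MeasureTheory.integrable_indicator_iff measurableSet_Ioc]
      exact MeasureTheory.integrableOn_const (by simp)
    · have hne : ∀ᵐ u : ℝ ∂MeasureTheory.volume, u ≠ x := by
        simp [MeasureTheory.ae_iff]
      filter_upwards [hne] with u hu
      by_cases h0 : 0 < u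
      · rcases lt_or_gt_of_ne hu with hlt | hgt
        · rw [Set.indicator_of_mem (show u ∈ Set.Ioc 0 x from ⟨h0, hlt.le⟩)]
          refine (qq_tendsto h0.le).congr' ?_
          filter_upwards [hX.eventually (lt_mem_nhds hlt)] with n hn
          rw [Set.indicator_of_mem (show u ∈ Set.Ioc 0 ((N n : ℝ) / Real.sqrt n) from ⟨h0, hn.le⟩)]
        · rw [Set.indicator_of_notMem (fun h => absurd h.2 (not_le.2 hgt))]
          refine tendsto_const_nhds.congr' ?_
          filter_upwards [hX.eventually (gt_mem_nhds hgt)] with n hn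
          rw [Set.indicator_of_notMem (fun h => absurd h.2 (not_le.2 hn))]
      · rw [Set.indicator_of_notMem (fun h => h0 h.1)]
        refine tendsto_const_nhds.congr ?_
        intro n
        rw [Set.indicator_of_notMem (fun h => h0 h.1)]
  rw [MeasureTheory.integral_indicator measurableSet_Ioc,
    ← intervalIntegral.integral_of_le hx.le] at main
  refine main.congr' ?_
  filter_upwards [hN1, eventually_gt_atTop 0] with n hn hn0
  rw [MeasureTheory.integral_indicator measurableSet_Ioc,
    ← intervalIntegral.integral_of_le (by positivity), cdf_eq n (T n) hn.1 hn.2.1,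
    ← sum_eq_qq n _ hn0]

lemma PXle_eq (n : ℕ) (t : ℝ) : PXle n t = (cnt n (fun w => (g w : ℝ) ≤ t) : ℝ) / 2 ^ n := by
  classical
  unfold PXle cnt
  congr 3

/-- Distribution function conditional on the first letter being `b`. -/
noncomputable def AA (m : ℕ) (t : ℝ) : ℝ :=
  (cnt m (fun w => (g (false :: w) : ℝ) ≤ t) : ℝ) / 2 ^ m

lemma AA_nonneg (m : ℕ) (t : ℝ) : 0 ≤ AA m t := by unfold AA; positivity

lemma AA_le_one (m : ℕ) (t : ℝ) : AA m t ≤ 1 := by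
  unfold AA
  rw [div_le_one (by positivity)]
  exact_mod_cast cnt_le m _

lemma PXle_succ (n : ℕ) (t : ℝ) : PXle (n + 1) t = (PXle n (t - 1) + AA n t) / 2 := by
  rw [PXle_eq, PXle_eq, AA, cnt_succ]
  have : cnt n (fun w => (g (true :: w) : ℝ) ≤ t) = cnt n (fun w => (g w : ℝ) ≤ t - 1) := by
    apply cnt_congr
    intro w _
    simp only [g]
    push_cast
    constructor <;> intro h <;> linarith
  rw [this, pow_succ]
  push_cast
  field_simp

lemma PXle_expand (n : ℕ) : ∀ t : ℝ, PXle n t =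
    ∑ k ∈ Finset.range n, (1 / 2 : ℝ) ^ (k + 1) * AA (n - 1 - k) (t - k) +
      (1 / 2 : ℝ) ^ n * PXle 0 (t - n) := by
  induction n with
  | zero => intro t; simp
  | succ n ih =>
    intro t
    rw [PXle_succ, ih, Finset.sum_range_succ']
    have : ∀ k ∈ Finset.range n, (1 / 2 : ℝ) ^ (k + 1 + 1) * AA (n + 1 - 1 - (k + 1)) (t - (k + 1 : ℕ))
        = (1 / 2) * ((1 / 2 : ℝ) ^ (k + 1) * AA (n - 1 - k) (t - 1 - k)) := by
      intro k _
      rw [show n + 1 - 1 - (k + 1) = n - 1 - k by omega,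
        show t - ((k + 1 : ℕ) : ℝ) = t - 1 - k by push_cast; ring]
      ring
    rw [Finset.sum_congr rfl this, ← Finset.mul_sum]
    rw [show t - ((n + 1 : ℕ) : ℝ) = t - 1 - n by push_cast; ring]
    simp
    ring

lemma cnt_rep (m : ℕ) : cnt m (fun w => w = List.replicate w.length false) ≤ 1 := by
  classical
  unfold cnt
  rw [Finset.card_le_one]
  intro a ha b hb
  simp only [Finset.mem_filter, Finset.mem_univ, true_and, List.length_ofFn] at ha hb
  exact List.ofFn_injective (ha.trans hb.symm)

lemma AA_close (m : ℕ) (t : ℝ) :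
    |AA m t - (cnt m (fun w => (chat w : ℝ) ≤ t) : ℝ) / 2 ^ m| ≤ (1 / 2) ^ m := by
  have hb : ∀ w : List Bool, ¬ w = List.replicate w.length false → g (false :: w) = chat w := by
    intro w h
    simp only [g]
    rw [if_neg h]
  have h1 : cnt m (fun w => (g (false :: w) : ℝ) ≤ t) ≤ cnt m (fun w => (chat w : ℝ) ≤ t) + 1 := by
    refine (cnt_mono ?_).trans ((cnt_or_le m (fun w => (chat w : ℝ) ≤ t)
      (fun w => w = List.replicate w.length false)).trans (Nat.add_le_add_left (cnt_rep m) _))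
    intro w _ h
    by_cases hw : w = List.replicate w.length false
    · exact Or.inr hw
    · rw [hb w hw] at h
      exact Or.inl h
  have h2 : cnt m (fun w => (chat w : ℝ) ≤ t) ≤ cnt m (fun w => (g (false :: w) : ℝ) ≤ t) + 1 := by
    refine (cnt_mono ?_).trans ((cnt_or_le m (fun w => (g (false :: w) : ℝ) ≤ t)
      (fun w => w = List.replicate w.length false)).trans (Nat.add_le_add_left (cnt_rep m) _))
    intro w _ h
    by_cases hw : w = List.replicate w.length false
    · exact Or.inr hw
    · rw [← hb w hw] at h
      exact Or.inl h
  have h1' : (cnt m (fun w => (g (false :: w) : ℝ) ≤ t) : ℝ) ≤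
    cnt m (fun w => (chat w : ℝ) ≤ t) + 1 := by exact_mod_cast h1
  have h2' : (cnt m (fun w => (chat w : ℝ) ≤ t) : ℝ) ≤
    cnt m (fun w => (g (false :: w) : ℝ) ≤ t) + 1 := by exact_mod_cast h2
  unfold AA
  rw [← sub_div, abs_div, abs_of_pos (by positivity : (0 : ℝ) < 2 ^ m), one_div, inv_pow, ← one_div]
  gcongr
  rw [abs_le]
  constructor <;> linarith

lemma AA_limit (x : ℝ) (hx : 0 < x) (k : ℕ) :
    Tendsto (fun n : ℕ => AA (n - 1 - k) ((n : ℝ) / 2 + x * Real.sqrt n - k)) atTop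
      (𝓝 (∫ t in (0:ℝ)..x,
        Real.sqrt (2 / Real.pi) * 8 * t ^ 2 * Real.exp (-2 * t ^ 2))) := by
  rw [← tendsto_add_atTop_iff_nat (k + 1)]
  set T : ℕ → ℝ := fun m => ((m + (k + 1) : ℕ) : ℝ) / 2 +
    x * Real.sqrt ((m + (k + 1) : ℕ) : ℝ) - k with hT
  have h1 : Tendsto (fun m : ℕ => (T m - m / 2) / Real.sqrt m) atTop (𝓝 x) := by
    apply tendsto_div_sqrt_of_bounded (D := k + 1 + x * (k + 1))
    refine Eventually.of_forall fun m => ?_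
    have hk : (0 : ℝ) ≤ k := Nat.cast_nonneg k
    have a1 : Real.sqrt (m : ℝ) ≤ Real.sqrt ((m + (k + 1) : ℕ) : ℝ) :=
      Real.sqrt_le_sqrt (by push_cast; linarith)
    have a2 : Real.sqrt ((m + (k + 1) : ℕ) : ℝ) ≤ Real.sqrt m + (k + 1) := by
      rw [Real.sqrt_le_left (by positivity)]
      have := Real.sq_sqrt (Nat.cast_nonneg (α := ℝ) m)
      push_cast
      nlinarith [Real.sqrt_nonneg (m : ℝ), mul_nonneg (Real.sqrt_nonneg (m : ℝ)) hk]
    have a3 : x * Real.sqrt (m : ℝ) ≤ x * Real.sqrt ((m + (k + 1) : ℕ) : ℝ) := by gcongr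
    have a4 : x * Real.sqrt ((m + (k + 1) : ℕ) : ℝ) ≤ x * (Real.sqrt m + (k + 1)) := by gcongr
    have a5 : 0 ≤ x * ((k : ℝ) + 1) := by positivity
    have e : T m - m / 2 - x * Real.sqrt m = ((k : ℝ) + 1) / 2 - k +
      (x * Real.sqrt ((m + (k + 1) : ℕ) : ℝ) - x * Real.sqrt m) := by
      simp only [hT]; push_cast; ring
    rw [e, abs_le]
    constructor <;> linarith
  have h2 := chat_limit x hx T h1
  have h3 : Tendsto (fun m : ℕ => AA m (T m) - (cnt m (fun w => (chat w : ℝ) ≤ T m) : ℝ) / 2 ^ m)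
      atTop (𝓝 0) := by
    refine squeeze_zero_norm (fun m => AA_close m (T m)) ?_
    exact tendsto_pow_atTop_nhds_zero_of_lt_one (by norm_num) (by norm_num)
  have h4 := h3.add h2
  rw [zero_add] at h4
  refine h4.congr ?_
  intro m
  rw [show m + (k + 1) - 1 - k = m by omega]
  simp [hT]

/-- Limit law for the number of correct guesses after a one-time riffle shuffle:
for every `x > 0`, `P(X_n ≤ n/2 + x√n) → ∫_0^x √(2/π)·8t²e^{-2t²} dt`, i.e.
`(X_n - n/2)/√n` converges in distribution to the Maxwell–Boltzmann law `G`. -/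
theorem stmt6 (x : ℝ) (hx : 0 < x) :
    Filter.Tendsto (fun n : ℕ => PXle n ((n : ℝ) / 2 + x * Real.sqrt n))
      Filter.atTop
      (nhds (∫ t in (0:ℝ)..x,
        Real.sqrt (2 / Real.pi) * 8 * t ^ 2 * Real.exp (-2 * t ^ 2))) := by
  set L := ∫ t in (0:ℝ)..x, Real.sqrt (2 / Real.pi) * 8 * t ^ 2 * Real.exp (-2 * t ^ 2) with hL
  have hsum : HasSum (fun k : ℕ => (1 / 2 : ℝ) ^ (k + 1)) 1 := by
    have := hasSum_geometric_two.mul_left (1 / 2 : ℝ)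
    rw [show (1 / 2 : ℝ) * 2 = 1 by norm_num] at this
    simpa only [pow_succ'] using this
  have h1 : Tendsto (fun n : ℕ => ∑' k : ℕ, if k < n then (1 / 2 : ℝ) ^ (k + 1) *
      AA (n - 1 - k) ((n : ℝ) / 2 + x * Real.sqrt n - k) else 0) atTop
      (𝓝 (∑' k : ℕ, (1 / 2 : ℝ) ^ (k + 1) * L)) := by
    apply tendsto_tsum_of_dominated_convergence hsum.summable
    · intro k
      refine ((AA_limit x hx k).const_mul _).congr' ?_
      filter_upwards [eventually_gt_atTop k] with n hn
      rw [if_pos hn]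
    · refine Eventually.of_forall fun n k => ?_
      split_ifs
      · rw [Real.norm_of_nonneg (mul_nonneg (by positivity) (AA_nonneg _ _))]
        exact mul_le_of_le_one_right (by positivity) (AA_le_one _ _)
      · simp
  have h2 : Tendsto (fun n : ℕ => (1 / 2 : ℝ) ^ n *
      PXle 0 ((n : ℝ) / 2 + x * Real.sqrt n - n)) atTop (𝓝 0) := by
    refine squeeze_zero (g := fun n : ℕ => (1 / 2 : ℝ) ^ n) ?_ ?_
      (tendsto_pow_atTop_nhds_zero_of_lt_one (by norm_num) (by norm_num))
    · intro n
      unfold PXle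
      positivity
    · intro n
      refine mul_le_of_le_one_right (by positivity) ?_
      rw [PXle_eq, div_le_one (by positivity)]
      exact_mod_cast cnt_le 0 _
  have h3 := h1.add h2
  rw [(hsum.mul_right L).tsum_eq, one_mul, add_zero] at h3
  refine h3.congr ?_
  intro n
  rw [PXle_expand n]
  congr 1
  rw [tsum_eq_sum (s := Finset.range n)]
  · apply Finset.sum_congr rfl
    intro k hk
    rw [if_pos (Finset.mem_range.1 hk)]
  · intro k hk
    rw [if_neg (fun h => hk (Finset.mem_range.2 h))]
end

section
/- For every fixed integer $r \ge 0$, the $r$-th moment of $Y_n = (X_n - n/2)/\sqrt{n}$, i.e. $\mathbb{E}(Y_n^r) = 2^{-n} \sum_{w \in \{a,b\}^n} \big((g(w) - n/2)/\sqrt{n}\big)^r$, converges as $n \to \infty$ to $\Gamma\big(\tfrac{r+3}{2}\big) \big/ \big(2^{r/2 - 1} \sqrt{\pi}\big)$, the $r$-th moment of the Maxwell–Boltzmann limit law $G$. -/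
/-- `E(Y_n^r) = 2^{-n} ∑_{w ∈ {a,b}^n} ((g(w) - n/2)/√n)^r`. -/
noncomputable def momY (n r : ℕ) : ℝ :=
  (∑ w : Fin n → Bool, (((g (List.ofFn w) : ℝ) - (n : ℝ) / 2) / Real.sqrt n) ^ r) / 2 ^ n

namespace RS
open Filter Topology

/-- Sum over words of length n. -/
noncomputable def S (n : ℕ) (F : List Bool → ℝ) : ℝ := ∑ w : Fin n → Bool, F (List.ofFn w)

lemma S_zero (F : List Bool → ℝ) : S 0 F = F [] := by simp [S]

lemma S_succ (n : ℕ) (F : List Bool → ℝ) :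
    S (n + 1) F = S n (fun w => F (true :: w)) + S n (fun w => F (false :: w)) := by
  unfold S
  rw [← (Fin.consEquiv (fun _ : Fin (n + 1) => Bool)).sum_comp, Fintype.sum_prod_type,
    Fintype.sum_bool]
  simp [Fin.consEquiv, List.ofFn_succ]

lemma S_add (n : ℕ) (F G : List Bool → ℝ) : S n (fun w => F w + G w) = S n F + S n G := by
  simp [S, Finset.sum_add_distrib]

lemma S_congr (n : ℕ) (F G : List Bool → ℝ) (h : ∀ w : List Bool, w.length = n → F w = G w) :
    S n F = S n G := by
  unfold S
  exact Finset.sum_congr rfl fun w _ => h _ (by simp)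

lemma S_sum {ι : Type*} (s : Finset ι) (n : ℕ) (F : ι → List Bool → ℝ) :
    S n (fun w => ∑ i ∈ s, F i w) = ∑ i ∈ s, S n (F i) := by
  unfold S
  exact Finset.sum_comm

lemma S_mul (n : ℕ) (c : ℝ) (F : List Bool → ℝ) : S n (fun w => c * F w) = c * S n F := by
  simp [S, Finset.mul_sum]

/-- weighted nonnegative paths -/
noncomputable def Q : ℕ → (ℕ → ℝ) → ℝ
  | 0, φ => φ 0
  | n + 1, φ => Q n (fun t => φ (t + 1) + if t = 0 then 0 else φ (t - 1))

lemma Q_add (n : ℕ) (φ ψ : ℕ → ℝ) : Q n (fun t => φ t + ψ t) = Q n φ + Q n ψ := by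
  induction n generalizing φ ψ with
  | zero => rfl
  | succ n ih =>
    simp only [Q]
    rw [← ih]
    congr 1
    funext t
    split_ifs <;> ring

lemma Q_mul (n : ℕ) (c : ℝ) (φ : ℕ → ℝ) : Q n (fun t => c * φ t) = c * Q n φ := by
  induction n generalizing φ with
  | zero => rfl
  | succ n ih =>
    simp only [Q]
    rw [← ih]
    congr 1
    funext t
    split_ifs <;> ring

lemma Q_sum {ι : Type*} (s : Finset ι) (n : ℕ) (F : ι → ℕ → ℝ) :
    Q n (fun w => ∑ i ∈ s, F i w) = ∑ i ∈ s, Q n (F i) := by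
  classical
  induction s using Finset.induction_on with
  | empty => simpa using Q_mul n 0 (fun _ => 0)
  | insert a s ha ih =>
    simp only [Finset.sum_insert ha]
    rw [Q_add, ih]

def sg (w : List Bool) : ℤ := (w.count true : ℤ) - w.count false
def X (w : List Bool) : ℕ := if 0 ≤ sg w then (sg w).toNat else (-1 - sg w).toNat
def T (w : List Bool) : ℤ := 2 * (chat w : ℤ) - w.length

lemma sg_true (w : List Bool) : sg (true :: w) = sg w + 1 := by simp [sg]; ring
lemma sg_false (w : List Bool) : sg (false :: w) = sg w - 1 := by simp [sg]; ring

lemma T_true (w : List Bool) : T (true :: w) = T w + if -1 ≤ sg w then 1 else -1 := by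
  have : (true :: w).count true ≥ (true :: w).count false ↔ -1 ≤ sg w := by
    simp [sg] <;> omega
  simp only [T, chat]
  rw [show decide ((true :: w).count true ≥ (true :: w).count false) = decide (-1 ≤ sg w) from
    decide_eq_decide.2 this]
  by_cases h : -1 ≤ sg w
  · simp [h] <;> ring
  · simp [h] <;> ring

lemma T_false (w : List Bool) : T (false :: w) = T w + if sg w ≤ 0 then 1 else -1 := by
  have : (false :: w).count true ≥ (false :: w).count false ↔ ¬ (sg w ≤ 0) := by
    simp [sg] <;> omega
  simp only [T, chat]
  rw [show decide ((false :: w).count true ≥ (false :: w).count false) = decide (¬ sg w ≤ 0) from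
    decide_eq_decide.2 this]
  by_cases h : sg w ≤ 0
  · simp [h] <;> ring
  · simp [h] <;> ring

lemma key_step (F : ℤ → ℕ → ℝ) (w : List Bool) :
    F (T (true :: w)) (X (true :: w)) + F (T (false :: w)) (X (false :: w)) =
      (fun (t : ℤ) (x : ℕ) => if x = 0 then F (t + 1) 1 + F (t + 1) 0
        else F (t + 1) (x + 1) + F (t - 1) (x - 1)) (T w) (X w) := by
  rw [T_true, T_false]
  unfold X
  rw [sg_true, sg_false]
  generalize sg w = s
  generalize T w = t
  rcases lt_trichotomy s (-1) with h | h | h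
  · have e1 : ¬ (-1 ≤ s) := by omega
    have e2 : s ≤ 0 := by omega
    have e3 : ¬ (0 ≤ s + 1) := by omega
    have e4 : ¬ (0 ≤ s - 1) := by omega
    have e5 : ¬ (0 ≤ s) := by omega
    have e6 : (-1 - s).toNat ≠ 0 := by omega
    simp only [e1, e2, e3, e4, e5, e6, if_true, if_false]
    rw [show (-1 - (s+1)).toNat = (-1 - s).toNat - 1 by omega,
      show (-1 - (s-1)).toNat = (-1 - s).toNat + 1 by omega, ← sub_eq_add_neg]
    ring
  · subst h
    norm_num
    ring
  · rcases eq_or_ne s 0 with h0 | h0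
    · subst h0; norm_num
    · have e1 : (-1 ≤ s) := by omega
      have e2 : ¬ s ≤ 0 := by omega
      have e3 : (0 ≤ s + 1) := by omega
      have e4 : (0 ≤ s - 1) := by omega
      have e5 : (0 ≤ s) := by omega
      have e6 : (s).toNat ≠ 0 := by omega
      simp only [e1, e2, e3, e4, e5, e6, if_true, if_false]
      rw [show (s+1).toNat = (s).toNat + 1 by omega,
        show (s-1).toNat = s.toNat - 1 by omega, ← sub_eq_add_neg]

lemma S_eq_Q (n : ℕ) (F : ℤ → ℕ → ℝ) :
    S n (fun w => F (T w) (X w)) = Q n (fun t => ∑ x ∈ Finset.range (t + 1), F t x) := by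
  induction n generalizing F with
  | zero => simp [S_zero, Q, T, X, sg, chat]
  | succ n ih =>
    rw [S_succ, ← S_add]
    simp only [key_step]
    rw [ih (fun (t : ℤ) (x : ℕ) => if x = 0 then F (t + 1) 1 + F (t + 1) 0
        else F (t + 1) (x + 1) + F (t - 1) (x - 1))]
    simp only [Q]
    congr 1
    funext t
    rw [Finset.sum_range_succ']
    simp only [Nat.add_eq_zero_iff, one_ne_zero, and_false, if_false, if_true, Nat.add_sub_cancel]
    rw [Finset.sum_add_distrib, Finset.sum_range_succ' _ (t + 1), Finset.sum_range_succ' _ t]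
    rcases t with _ | t
    · simp
    · simp
      ring

/-- Moments -/
noncomputable def M (k n : ℕ) : ℝ := Q n (fun t => ((t : ℝ) + 1) ^ k) / 2 ^ n

lemma S_T_pow (r n : ℕ) : S n (fun w => ((T w : ℝ) + 1) ^ r) / 2 ^ n = M (r + 1) n := by
  rw [S_eq_Q n (fun t _ => ((t : ℝ) + 1) ^ r)]
  unfold M
  congr 2
  funext t
  simp [pow_succ, mul_comm]

lemma M_one (n : ℕ) : M 1 n = 1 := by
  rw [← S_T_pow 0 n]
  simp [S]

lemma M_succ (k n : ℕ) : M (k + 2) (n + 1) = M (k + 2) n + ∑ m ∈ Finset.range (k + 2),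
    (((k + 2).choose m : ℝ) * (1 + (-1) ^ (k + 2 - m)) / 2) * M m n := by
  have h : Q (n + 1) (fun t => ((t : ℝ) + 1) ^ (k + 2)) =
      Q n (fun t => ∑ m ∈ Finset.range (k + 3),
        (((k + 2).choose m : ℝ) * (1 + (-1) ^ (k + 2 - m))) * ((t : ℝ) + 1) ^ m) := by
    simp only [Q]
    congr 1
    funext t
    have h1 : (if t = 0 then (0 : ℝ) else (((t - 1 : ℕ) : ℝ) + 1) ^ (k + 2))
        = (((t : ℝ) + 1) + (-1)) ^ (k + 2) := by
      rcases t with _ | t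
      · simp
      · simp
    rw [h1]
    push_cast
    rw [add_pow ((t : ℝ) + 1) 1, add_pow ((t : ℝ) + 1) (-1), ← Finset.sum_add_distrib]
    refine Finset.sum_congr rfl fun m _ => ?_
    ring
  unfold M
  rw [h, Q_sum]
  simp only [Q_mul]
  rw [Finset.sum_range_succ, pow_succ]
  simp only [Nat.choose_self, Nat.sub_self, pow_zero]
  rw [add_div, add_comm, Finset.sum_div]
  congr 1
  · push_cast; field_simp; ring
  · refine Finset.sum_congr rfl fun m _ => ?_
    field_simp

lemma Q_tail (n j : ℕ) : Q n (fun t => if j ≤ t then 1 else 0) = (n.choose ((n + j + 1) / 2) : ℝ) := by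
  induction n generalizing j with
  | zero =>
    rcases j with _ | j
    · simp [Q]
    · simp only [Q]
      rw [Nat.choose_eq_zero_of_lt (by omega)]
      simp
  | succ n ih =>
    rcases j with _ | j
    · have : Q (n + 1) (fun t => if 0 ≤ t then (1 : ℝ) else 0) =
          Q n (fun t => (if 0 ≤ t then 1 else 0) + (if 1 ≤ t then 1 else 0)) := by
        simp only [Q]
        congr 1
        funext t
        rcases t with _ | t <;> simp
      rw [this, Q_add, ih, ih]
      rw [show (n + 1 + 0 + 1) / 2 = n / 2 + 1 by omega, Nat.choose_succ_succ,
        Nat.succ_eq_add_one]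
      rw [← Nat.choose_symm (show n / 2 ≤ n by omega),
        show n - n / 2 = (n + 0 + 1) / 2 by omega]
      push_cast; rfl
    · have : Q (n + 1) (fun t => if j + 1 ≤ t then (1 : ℝ) else 0) =
          Q n (fun t => (if j ≤ t then 1 else 0) + (if j + 2 ≤ t then 1 else 0)) := by
        simp only [Q]
        congr 1
        funext t
        rcases t with _ | t <;> simp
      rw [this, Q_add, ih, ih]
      rw [show (n + 1 + (j + 1) + 1) / 2 = (n + j + 1) / 2 + 1 by omega, Nat.choose_succ_succ,
        show (n + (j + 2) + 1) / 2 = (n + j + 1) / 2 + 1 by omega]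
      push_cast; rfl

lemma M_zero (n : ℕ) : M 0 n = (n.choose ((n + 1) / 2) : ℝ) / 2 ^ n := by
  have := Q_tail n 0
  simp only [Nat.zero_le, if_true, Nat.add_zero] at this
  simp [M, this]

lemma M_zero_sq (n : ℕ) : (M 0 n) ^ 2 * n =
    (Real.Wallis.W ((n + 1) / 2))⁻¹ * ((n : ℝ) / (2 * ((n + 1) / 2 : ℕ) + 1)) := by
  have h : M 0 n = (Nat.centralBinom ((n + 1) / 2) : ℝ) / 4 ^ ((n + 1) / 2) := by
    rw [M_zero]
    rcases Nat.even_or_odd' n with ⟨m, rfl | rfl⟩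
    · rw [show (2 * m + 1) / 2 = m by omega, Nat.centralBinom, pow_mul]
      norm_num
    · rw [show (2 * m + 1 + 1) / 2 = m + 1 by omega]
      have h1 := Nat.choose_succ_succ (2 * m + 1) m
      have h2 : (2 * m + 1).choose m = (2 * m + 1).choose (m + 1) :=
        Nat.choose_symm_half m |>.symm
      have h3 : (Nat.centralBinom (m + 1) : ℝ) = 2 * ((2 * m + 1).choose (m + 1) : ℝ) := by
        rw [Nat.centralBinom, show 2 * (m + 1) = (2 * m + 1) + 1 by ring, Nat.choose_succ_succ, h2]
        push_cast
        rw [Nat.succ_eq_add_one]; ring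
      rw [h3, show (4 : ℝ) = 2 ^ 2 by norm_num, ← pow_mul, show 2 * (m + 1) = 2 * m + 1 + 1 by ring,
        pow_succ _ (2 * m + 1)]
      field_simp
  rw [h]
  generalize (n + 1) / 2 = m
  rw [Real.Wallis.W_eq_factorial_ratio]
  have hc : (Nat.centralBinom m : ℝ) * (m.factorial : ℝ) ^ 2 = (2 * m).factorial := by
    have := Nat.choose_mul_factorial_mul_factorial (show m ≤ 2 * m by omega)
    rw [show 2 * m - m = m by omega] at this
    rw [← this, Nat.centralBinom]
    push_cast; ring
  rw [← hc]
  have h4 : (2 : ℝ) ^ (4 * m) = (4 ^ m) ^ 2 := by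
    rw [← pow_mul, show (4 : ℝ) = 2 ^ 2 by norm_num, ← pow_mul]; congr 1; ring
  rw [h4]
  have : (m.factorial : ℝ) ≠ 0 := by positivity
  field_simp

lemma half_tendsto : Tendsto (fun n : ℕ => (n + 1) / 2) atTop atTop := by
  refine tendsto_atTop.2 fun b => ?_
  filter_upwards [eventually_ge_atTop (2 * b)] with n hn
  omega

lemma ratio_tendsto : Tendsto (fun n : ℕ => (n : ℝ) / (2 * ((n + 1) / 2 : ℕ) + 1)) atTop (𝓝 1) := by
  have h1 : Tendsto (fun n : ℕ => 1 - 2 / ((n : ℝ) + 1)) atTop (𝓝 1) := by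
    have : Tendsto (fun n : ℕ => 2 / ((n : ℝ) + 1)) atTop (𝓝 0) :=
      tendsto_const_nhds.div_atTop (tendsto_atTop_add_const_right _ _ tendsto_natCast_atTop_atTop)
    simpa using this.const_sub 1
  refine tendsto_of_tendsto_of_tendsto_of_le_of_le h1 tendsto_const_nhds ?_ ?_
  · intro n
    have a1 : ((2 * ((n + 1) / 2) : ℕ) : ℝ) ≤ ((n + 1 : ℕ) : ℝ) := by exact_mod_cast (by omega)
    have a2 : ((n : ℕ) : ℝ) ≤ ((2 * ((n + 1) / 2) : ℕ) : ℝ) := by exact_mod_cast (by omega)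
    push_cast at a1 a2
    have hn : (0 : ℝ) ≤ n := by positivity
    show 1 - 2 / ((n : ℝ) + 1) ≤ _
    have e : 1 - 2 / ((n : ℝ) + 1) = (n - 1) / (n + 1) := by field_simp; ring
    rw [e, div_le_div_iff₀ (by positivity) (by positivity)]
    nlinarith
  · intro n
    have a2 : ((n : ℕ) : ℝ) ≤ ((2 * ((n + 1) / 2) : ℕ) : ℝ) := by exact_mod_cast (by omega)
    push_cast at a2
    show (n : ℝ) / (2 * ((n + 1) / 2 : ℕ) + 1) ≤ 1
    rw [div_le_one (by positivity)]
    linarith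

/-- limit constants -/
noncomputable def C (k : ℕ) : ℝ :=
  2 ^ (((k : ℝ) + 1) / 2) * Real.Gamma ((k : ℝ) / 2 + 1) / Real.sqrt Real.pi

lemma C_zero : C 0 = Real.sqrt (2 / Real.pi) := by
  unfold C
  rw [Real.sqrt_div (by norm_num), Real.sqrt_eq_rpow 2]
  simp

lemma C_one : C 1 = 1 := by
  unfold C
  have := Real.pi_pos
  have : Real.sqrt Real.pi ≠ 0 := by positivity
  rw [Nat.cast_one, Real.Gamma_add_one (by norm_num), Real.Gamma_one_half_eq]
  norm_num
  field_simp

lemma C_succ (k : ℕ) : C (k + 2) = (k + 2) * C k := by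
  unfold C
  push_cast
  rw [show ((k : ℝ) + 2 + 1) / 2 = ((k : ℝ) + 1) / 2 + 1 by ring, Real.rpow_add_one (by norm_num),
    show ((k : ℝ) + 2) / 2 + 1 = ((k : ℝ) / 2 + 1) + 1 by ring, Real.Gamma_add_one (by positivity)]
  ring

lemma M_zero_tendsto : Tendsto (fun n : ℕ => M 0 n / (n : ℝ) ^ (((0 : ℝ) - 1) / 2)) atTop (𝓝 (C 0)) := by
  have h : ∀ n : ℕ, M 0 n / (n : ℝ) ^ (((0 : ℝ) - 1) / 2) = Real.sqrt ((M 0 n) ^ 2 * n) := by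
    intro n
    rw [Real.sqrt_mul (by positivity), Real.sqrt_sq (by rw [M_zero]; positivity),
      show ((0 : ℝ) - 1) / 2 = -(1 / 2) by ring, Real.rpow_neg (by positivity),
      Real.sqrt_eq_rpow (n : ℝ), div_inv_eq_mul]
  simp only [h, M_zero_sq, C_zero]
  refine (Real.continuous_sqrt.tendsto _).comp ?_
  have := ((Real.Wallis.tendsto_W_nhds_pi_div_two.comp half_tendsto).inv₀
    (by have := Real.pi_pos; positivity)).mul ratio_tendsto
  simpa using this

lemma rpow_diff (β : ℝ) :
    Tendsto (fun n : ℕ => (((n : ℝ) + 1) ^ β - (n : ℝ) ^ β) / (n : ℝ) ^ (β - 1)) atTop (𝓝 β) := by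
  have hd : HasDerivAt (fun x : ℝ => x ^ β) β 1 := by
    simpa using Real.hasDerivAt_rpow_const (x := 1) (p := β) (Or.inl one_ne_zero)
  have h := hd.tendsto_slope_zero_right
  have hi : Tendsto (fun n : ℕ => ((n : ℝ))⁻¹) atTop (𝓝[>] 0) :=
    tendsto_inv_atTop_nhdsGT_zero.comp tendsto_natCast_atTop_atTop
  refine (h.comp hi).congr' ?_
  filter_upwards [eventually_gt_atTop 0] with n hn
  have hn' : (0 : ℝ) < n := by exact_mod_cast hn
  simp only [Function.comp, inv_inv, smul_eq_mul, Real.one_rpow]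
  rw [Real.rpow_sub_one hn'.ne', show (n : ℝ) + 1 = n * (1 + (n : ℝ)⁻¹) by field_simp,
    Real.mul_rpow hn'.le (by positivity)]
  have : (n : ℝ) ^ β ≠ 0 := by positivity
  field_simp

lemma stolz (a d : ℕ → ℝ) (β L : ℝ) (hβ : 0 < β) (had : ∀ n, a (n + 1) = a n + d n)
    (hd : Tendsto (fun n : ℕ => d n / (n : ℝ) ^ (β - 1)) atTop (𝓝 (L * β))) :
    Tendsto (fun n : ℕ => a n / (n : ℝ) ^ β) atTop (𝓝 L) := by
  set G : ℕ → ℝ := fun n => ((n + 1 : ℕ) : ℝ) ^ β - (n : ℝ) ^ β with hG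
  have hGs : ∀ n, ∑ i ∈ Finset.range n, G i = (n : ℝ) ^ β := by
    intro n
    rw [Finset.sum_range_sub (fun i : ℕ => (i : ℝ) ^ β)]
    simp [Real.zero_rpow hβ.ne']
  have hGpos : ∀ n, 0 < G n := by
    intro n
    have : (n : ℝ) ^ β < ((n + 1 : ℕ) : ℝ) ^ β :=
      Real.rpow_lt_rpow (by positivity) (by push_cast; linarith) hβ
    simp only [hG]; linarith
  have hinf : Tendsto (fun n : ℕ => (n : ℝ) ^ β) atTop atTop :=
    (tendsto_rpow_atTop hβ).comp tendsto_natCast_atTop_atTop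
  have hdG : Tendsto (fun n => d n / G n) atTop (𝓝 L) := by
    have := hd.div (rpow_diff β) hβ.ne'
    rw [mul_div_assoc, div_self hβ.ne', mul_one] at this
    refine this.congr' ?_
    filter_upwards [eventually_gt_atTop 0] with n hn
    have hn' : (0 : ℝ) < n := by exact_mod_cast hn
    have h2 : (n : ℝ) ^ (β - 1) ≠ 0 := by positivity
    simp only [hG, Pi.div_apply]
    push_cast
    rw [div_div_div_cancel_right₀ h2]
  have ho : (fun n => d n - L * G n) =o[atTop] G := by
    rw [Asymptotics.isLittleO_iff_tendsto (fun n h => absurd h (hGpos n).ne')]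
    have := hdG.sub_const L
    rw [sub_self] at this
    refine this.congr fun n => ?_
    have := (hGpos n).ne'
    field_simp
  have hs := ho.sum_range (fun n => (hGpos n).le) (by simpa only [hGs] using hinf)
  have ha : ∀ n, ∑ i ∈ Finset.range n, (d i - L * G i) = a n - a 0 - L * (n : ℝ) ^ β := by
    intro n
    rw [Finset.sum_sub_distrib, ← Finset.mul_sum, hGs]
    congr 1
    rw [← Finset.sum_range_sub a n]
    exact Finset.sum_congr rfl fun i _ => by rw [had]; ring
  simp only [hGs, ha] at hs
  have h0 := hs.tendsto_div_nhds_zero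
  have h1 : Tendsto (fun n : ℕ => a 0 / (n : ℝ) ^ β) atTop (𝓝 0) := tendsto_const_nhds.div_atTop hinf
  have h2 := (h0.add h1).add_const L
  rw [zero_add, zero_add] at h2
  refine h2.congr' ?_
  filter_upwards [eventually_gt_atTop 0] with n hn
  have hn' : (0 : ℝ) < n := by exact_mod_cast hn
  have : (n : ℝ) ^ β ≠ 0 := by positivity
  field_simp
  ring

lemma lower_order (f : ℕ → ℝ) (α γ c : ℝ) (h : α < γ)
    (hf : Tendsto (fun n : ℕ => f n / (n : ℝ) ^ α) atTop (𝓝 c)) :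
    Tendsto (fun n : ℕ => f n / (n : ℝ) ^ γ) atTop (𝓝 0) := by
  have h1 : Tendsto (fun n : ℕ => (n : ℝ) ^ (-(γ - α))) atTop (𝓝 0) :=
    (tendsto_rpow_neg_atTop (by linarith)).comp tendsto_natCast_atTop_atTop
  have := hf.mul h1
  rw [mul_zero] at this
  refine this.congr' ?_
  filter_upwards [eventually_gt_atTop 0] with n hn
  have hn' : (0 : ℝ) < n := by exact_mod_cast hn
  rw [neg_sub, Real.rpow_sub hn']
  have : (n : ℝ) ^ α ≠ 0 := by positivity
  field_simp

lemma M_tendsto (k : ℕ) :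
    Tendsto (fun n : ℕ => M k n / (n : ℝ) ^ (((k : ℝ) - 1) / 2)) atTop (𝓝 (C k)) := by
  induction k using Nat.strong_induction_on with
  | _ k ih =>
    match k, ih with
    | 0, _ => simpa using M_zero_tendsto
    | 1, _ => simp [M_one, C_one]
    | k + 2, ih =>
      refine stolz (M (k + 2)) _ _ _ (by push_cast; linarith [(Nat.cast_nonneg k : (0 : ℝ) ≤ k)])
        (M_succ k) ?_
      rw [C_succ]
      have e : (((k + 2 : ℕ) : ℝ) - 1) / 2 - 1 = ((k : ℝ) - 1) / 2 := by push_cast; ring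
      rw [e]
      have hlow : ∀ m ∈ Finset.range k, Tendsto (fun n : ℕ =>
          ((((k + 2).choose m : ℝ) * (1 + (-1) ^ (k + 2 - m)) / 2) * M m n)
            / (n : ℝ) ^ (((k : ℝ) - 1) / 2)) atTop (𝓝 0) := by
        intro m hm
        have hm' := Finset.mem_range.1 hm
        have hmk : (m : ℝ) < k := by exact_mod_cast hm'
        have := (lower_order _ _ (((k : ℝ) - 1) / 2) _ (by linarith) (ih m (by omega))).const_mul
          (((k + 2).choose m : ℝ) * (1 + (-1) ^ (k + 2 - m)) / 2)
        simpa [mul_div_assoc] using this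
      have hsum := tendsto_finsetSum _ hlow
      have htop := (ih k (by omega)).const_mul (((k : ℝ) + 2) * ((k : ℝ) + 1) / 2)
      have := hsum.add htop
      have hch : ((k + 2).choose k : ℝ) = ((k : ℝ) + 2) * ((k : ℝ) + 1) / 2 := by
        rw [← Nat.choose_symm (by omega), show k + 2 - k = 2 by omega, Nat.cast_choose_two]
        push_cast; ring
      convert! this using 1
      · funext n
        rw [Finset.sum_range_succ, Finset.sum_range_succ, show k + 2 - (k + 1) = 1 by omega,
          show k + 2 - k = 2 by omega, hch, ← Finset.sum_div]
        ring
      · congr 1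
        rw [Finset.sum_const_zero]
        push_cast
        ring

lemma contraction (x q y : ℕ → ℝ) (h : ∀ᶠ n in atTop, x (n + 1) = q n * x n + y n)
    (hq : ∀ n, |q n| ≤ 1 / 2) (hy : Tendsto y atTop (𝓝 0)) : Tendsto x atTop (𝓝 0) := by
  rw [Metric.tendsto_atTop]
  intro ε hε
  have hy' : ∀ᶠ n in atTop, |y n| < ε / 4 := by
    have := (Metric.tendsto_nhds.1 hy) (ε / 4) (by linarith)
    simpa [Real.dist_eq] using this
  obtain ⟨N, hN⟩ := eventually_atTop.1 (h.and hy')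
  have hb : ∀ k, |x (N + k)| ≤ (1 / 2) ^ k * |x N| + ε / 2 := by
    intro k
    induction k with
    | zero => simp; linarith
    | succ k ih =>
      obtain ⟨h1, h2⟩ := hN (N + k) (by omega)
      rw [← Nat.add_assoc, h1]
      calc |q (N + k) * x (N + k) + y (N + k)| ≤ |q (N + k)| * |x (N + k)| + |y (N + k)| := by
            rw [← abs_mul]; exact abs_add_le _ _
        _ ≤ 1 / 2 * ((1 / 2) ^ k * |x N| + ε / 2) + ε / 4 := by
            have := mul_le_mul (hq (N + k)) ih (abs_nonneg _) (by norm_num)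
            linarith
        _ = _ := by ring
  have hp : Tendsto (fun k : ℕ => (1 / 2 : ℝ) ^ k * |x N|) atTop (𝓝 0) := by
    simpa using (tendsto_pow_atTop_nhds_zero_of_lt_one (by norm_num : (0 : ℝ) ≤ 1 / 2)
      (by norm_num)).mul_const |x N|
  obtain ⟨K, hK⟩ := eventually_atTop.1 (hp.eventually_lt_const (show (0 : ℝ) < ε / 2 by linarith))
  refine ⟨N + K, fun n hn => ?_⟩
  obtain ⟨k, rfl⟩ := Nat.exists_eq_add_of_le (show N ≤ n by omega)
  have := hK k (by omega)
  have := hb k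
  rw [Real.dist_eq, sub_zero]
  linarith

lemma average (a R : ℕ → ℝ) (α c : ℝ) (hα : 0 ≤ α) (h : ∀ n, a (n + 1) = a n / 2 + R n / 2)
    (hR : Tendsto (fun n : ℕ => R n / (n : ℝ) ^ α) atTop (𝓝 c)) :
    Tendsto (fun n : ℕ => a n / (n : ℝ) ^ α) atTop (𝓝 c) := by
  set ρ : ℕ → ℝ := fun n => ((n : ℝ) / ((n : ℝ) + 1)) ^ α with hρ
  have hρ1 : ∀ n, |ρ n| ≤ 1 := by
    intro n
    have h0 : (0 : ℝ) ≤ (n : ℝ) / ((n : ℝ) + 1) := by positivity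
    rw [abs_of_nonneg (Real.rpow_nonneg h0 _)]
    exact Real.rpow_le_one h0 ((div_le_one (by positivity)).2 (by linarith)) hα
  have hρt : Tendsto ρ atTop (𝓝 1) := by
    have h1 : Tendsto (fun n : ℕ => (n : ℝ) / ((n : ℝ) + 1)) atTop (𝓝 1) :=
      tendsto_natCast_div_add_atTop (1 : ℝ)
    have := h1.rpow_const (p := α) (Or.inl one_ne_zero)
    simpa using this
  have key := contraction (fun n => a n / (n : ℝ) ^ α - c) (fun n => ρ n / 2)
    (fun n => ρ n * c / 2 + ρ n * (R n / (n : ℝ) ^ α) / 2 - c) ?_ ?_ ?_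
  · simpa using key.add_const c
  · filter_upwards [eventually_gt_atTop 0] with n hn
    have hn' : (0 : ℝ) < n := by exact_mod_cast hn
    have h1 : (n : ℝ) ^ α ≠ 0 := by positivity
    have h2 : ((n : ℝ) + 1) ^ α ≠ 0 := by positivity
    simp only [hρ]
    rw [h, Real.div_rpow hn'.le (by positivity)]
    push_cast
    field_simp
    ring
  · intro n
    rw [abs_div, abs_two]
    linarith [hρ1 n]
  · have := (((hρt.mul_const c).div_const 2).add ((hρt.mul hR).div_const 2)).sub_const c
    convert! this using 2
    ring

/-- centered doubled count -/
noncomputable def Gz (w : List Bool) : ℝ := 2 * (g w : ℝ) - w.length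

noncomputable def A (r n : ℕ) : ℝ := S n (fun w => Gz w ^ r) / 2 ^ n

noncomputable def err (r n : ℕ) : ℝ :=
  S n (fun w => Gz (false :: w) ^ r - ((T w : ℝ) - 1) ^ r) / 2 ^ n

lemma Gz_true (w : List Bool) : Gz (true :: w) = Gz w + 1 := by
  simp [Gz, g]; ring

lemma chat_le (w : List Bool) : chat w ≤ w.length := by
  induction w with
  | nil => simp [chat]
  | cons x w ih =>
    rw [chat, List.length_cons]
    split_ifs <;> omega

lemma err_pt (r n : ℕ) (w : List Bool) (hw : w.length = n) :
    |Gz (false :: w) ^ r - ((T w : ℝ) - 1) ^ r| ≤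
      if w = List.replicate n false then 2 * ((n : ℝ) + 1) ^ r else 0 := by
  subst hw
  split_ifs with h
  · have h1 : Gz (false :: w) = (w.length : ℝ) + 1 := by
      simp only [Gz, g, if_pos h, List.length_cons]; push_cast; ring
    have hc : (chat w : ℝ) ≤ w.length := by exact_mod_cast chat_le w
    have hc0 : (0 : ℝ) ≤ chat w := by positivity
    have h2 : |(T w : ℝ) - 1| ≤ (w.length : ℝ) + 1 := by
      simp only [T]
      push_cast
      rw [abs_le]
      constructor <;> linarith
    have h3 : |((T w : ℝ) - 1) ^ r| ≤ ((w.length : ℝ) + 1) ^ r := by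
      rw [abs_pow]; exact pow_le_pow_left₀ (abs_nonneg _) h2 r
    have h4 : |((w.length : ℝ) + 1) ^ r| = ((w.length : ℝ) + 1) ^ r := abs_of_nonneg (by positivity)
    rw [h1]
    refine (abs_sub _ _).trans ?_
    linarith
  · have : Gz (false :: w) = (T w : ℝ) - 1 := by
      simp only [Gz, g, if_neg h, List.length_cons, T]; push_cast; ring
    rw [this]; simp

lemma err_le (r n : ℕ) : |err r n| ≤ 2 * ((n : ℝ) + 1) ^ r / 2 ^ n := by
  unfold err
  rw [abs_div, abs_of_pos (show (0 : ℝ) < 2 ^ n by positivity)]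
  gcongr
  unfold S
  refine (Finset.abs_sum_le_sum_abs _ _).trans ?_
  refine (Finset.sum_le_sum fun w _ => err_pt r n (List.ofFn w) (by simp)).trans ?_
  have : ∀ w : Fin n → Bool, (List.ofFn w = List.replicate n false) ↔ w = fun _ => false := by
    intro w
    rw [← List.ofFn_const, List.ofFn_inj]
  simp only [this]
  simp

lemma err_tendsto (r : ℕ) :
    Tendsto (fun n : ℕ => err r n / (n : ℝ) ^ ((r : ℝ) / 2)) atTop (𝓝 0) := by
  have h0 : Tendsto (fun n : ℕ => 2 * ((n : ℝ) + 1) ^ r / 2 ^ n) atTop (𝓝 0) := by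
    have := (tendsto_pow_const_div_const_pow_of_one_lt r (show (1 : ℝ) < 2 by norm_num))
    have := ((tendsto_add_atTop_iff_nat 1).2 this).const_mul 4
    rw [mul_zero] at this
    refine this.congr fun n => ?_
    push_cast
    rw [pow_succ 2 n]
    field_simp
    ring
  rw [tendsto_zero_iff_abs_tendsto_zero]
  refine squeeze_zero' (Eventually.of_forall fun n => abs_nonneg _) ?_ h0
  filter_upwards [eventually_ge_atTop 1] with n hn
  have hn' : (1 : ℝ) ≤ n := by exact_mod_cast hn
  have h1 : (1 : ℝ) ≤ (n : ℝ) ^ ((r : ℝ) / 2) := Real.one_le_rpow hn' (by positivity)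
  simp only [Function.comp]
  rw [abs_div, abs_of_pos (by linarith : (0 : ℝ) < (n : ℝ) ^ ((r : ℝ) / 2))]
  exact (div_le_self (abs_nonneg _) h1).trans (err_le r n)

lemma S_Tm (r n : ℕ) : S n (fun w => ((T w : ℝ) - 1) ^ r) / 2 ^ n =
    ∑ m ∈ Finset.range (r + 1), ((-2) ^ (r - m) * (r.choose m : ℝ)) * M (m + 1) n := by
  have : (fun w => ((T w : ℝ) - 1) ^ r) = fun w => ∑ m ∈ Finset.range (r + 1),
      ((-2) ^ (r - m) * (r.choose m : ℝ)) * ((T w : ℝ) + 1) ^ m := by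
    funext w
    rw [show (T w : ℝ) - 1 = ((T w : ℝ) + 1) + (-2) by ring, add_pow]
    exact Finset.sum_congr rfl fun m _ => by ring
  rw [this, S_sum, Finset.sum_div]
  refine Finset.sum_congr rfl fun m _ => ?_
  rw [S_mul, ← S_T_pow, mul_div_assoc]

lemma A_succ (r n : ℕ) : A r (n + 1) = A r n / 2 +
    (∑ m ∈ Finset.range r, (r.choose m : ℝ) * A m n + (err r n +
      ∑ m ∈ Finset.range (r + 1), ((-2) ^ (r - m) * (r.choose m : ℝ)) * M (m + 1) n)) / 2 := by
  have h1 : S n (fun w => Gz (true :: w) ^ r) / 2 ^ n =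
      ∑ m ∈ Finset.range (r + 1), (r.choose m : ℝ) * A m n := by
    have : (fun w => Gz (true :: w) ^ r) = fun w => ∑ m ∈ Finset.range (r + 1),
        (r.choose m : ℝ) * Gz w ^ m := by
      funext w
      rw [Gz_true, add_pow]
      exact Finset.sum_congr rfl fun m _ => by ring
    rw [this, S_sum, Finset.sum_div]
    refine Finset.sum_congr rfl fun m _ => ?_
    rw [S_mul, A, mul_div_assoc]
  have h2 : S n (fun w => Gz (false :: w) ^ r) / 2 ^ n = err r n +
      ∑ m ∈ Finset.range (r + 1), ((-2) ^ (r - m) * (r.choose m : ℝ)) * M (m + 1) n := by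
    rw [← S_Tm, err, ← add_div, ← S_add]
    simp
  rw [← h2]
  have : A r (n + 1) = (S n (fun w => Gz (true :: w) ^ r) / 2 ^ n +
      S n (fun w => Gz (false :: w) ^ r) / 2 ^ n) / 2 := by
    rw [A, S_succ, pow_succ]
    field_simp
  rw [this, h1, Finset.sum_range_succ]
  simp only [Nat.choose_self]
  push_cast
  ring

lemma A_tendsto (r : ℕ) :
    Tendsto (fun n : ℕ => A r n / (n : ℝ) ^ ((r : ℝ) / 2)) atTop (𝓝 (C (r + 1))) := by
  induction r using Nat.strong_induction_on with
  | _ r ih =>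
    refine average (A r) _ _ _ (by positivity) (A_succ r) ?_
    have e1 : Tendsto (fun n : ℕ => (∑ m ∈ Finset.range r, (r.choose m : ℝ) * A m n)
        / (n : ℝ) ^ ((r : ℝ) / 2)) atTop (𝓝 0) := by
      simp only [Finset.sum_div]
      refine (tendsto_finsetSum _ fun m hm => ?_).trans
        (le_of_eq (congrArg 𝓝 (Finset.sum_const_zero (s := Finset.range r))))
      have hm' := Finset.mem_range.1 hm
      have hmk : (m : ℝ) < r := by exact_mod_cast hm'
      have := (lower_order _ _ ((r : ℝ) / 2) _ (by linarith) (ih m hm')).const_mul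
        (r.choose m : ℝ)
      simpa [mul_div_assoc] using this
    have e2 : Tendsto (fun n : ℕ => (∑ m ∈ Finset.range r,
        ((-2) ^ (r - m) * (r.choose m : ℝ)) * M (m + 1) n)
        / (n : ℝ) ^ ((r : ℝ) / 2)) atTop (𝓝 0) := by
      simp only [Finset.sum_div]
      refine (tendsto_finsetSum _ fun m hm => ?_).trans
        (le_of_eq (congrArg 𝓝 (Finset.sum_const_zero (s := Finset.range r))))
      have hm' := Finset.mem_range.1 hm
      have hmk : (m : ℝ) < r := by exact_mod_cast hm'
      have := (lower_order _ _ ((r : ℝ) / 2) _ (by push_cast; linarith)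
        (M_tendsto (m + 1))).const_mul ((-2) ^ (r - m) * (r.choose m : ℝ))
      simpa [mul_div_assoc] using this
    have e3 := M_tendsto (r + 1)
    rw [show (((r + 1 : ℕ) : ℝ) - 1) / 2 = (r : ℝ) / 2 by push_cast; ring] at e3
    have := ((e1.add (err_tendsto r)).add e2).add e3
    simp only [zero_add] at this
    refine this.congr fun n => ?_
    rw [Finset.sum_range_succ _ r]
    simp only [Nat.sub_self, pow_zero, Nat.choose_self]
    push_cast
    ring

lemma momY_eq (n r : ℕ) : momY n r = A r n / (n : ℝ) ^ ((r : ℝ) / 2) / 2 ^ r := by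
  have hs : (n : ℝ) ^ ((r : ℝ) / 2) = Real.sqrt n ^ r := by
    rw [Real.sqrt_eq_rpow, ← Real.rpow_natCast, ← Real.rpow_mul (by positivity)]
    congr 1; ring
  rw [hs, momY, A, S, div_right_comm _ ((2 : ℝ) ^ n) _, div_right_comm _ ((2 : ℝ) ^ n) _]
  congr 1
  rw [Finset.sum_div, Finset.sum_div]
  refine Finset.sum_congr rfl fun w _ => ?_
  rw [← div_pow, ← div_pow]
  congr 1
  simp only [Gz, List.length_ofFn]
  ring

end RS

/-- Moment convergence: for every fixed `r ≥ 0`,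
`E(Y_n^r) → Γ((r+3)/2) / (2^(r/2-1) √π)`, the `r`-th moment of the
Maxwell–Boltzmann limit law `G`. -/
theorem stmt7 (r : ℕ) :
    Filter.Tendsto (fun n : ℕ => momY n r) Filter.atTop
      (nhds (Real.Gamma (((r : ℝ) + 3) / 2) /
        ((2 : ℝ) ^ ((r : ℝ) / 2 - 1) * Real.sqrt Real.pi))) := by
  have h := (RS.A_tendsto r).div_const (2 ^ r)
  simp only [← RS.momY_eq] at h
  convert! h using 2
  unfold RS.C
  have hpi : Real.sqrt Real.pi ≠ 0 := by have := Real.pi_pos; positivity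
  have h2 : (2 : ℝ) ^ ((r : ℝ) / 2 - 1) * (2 : ℝ) ^ ((((r + 1 : ℕ) : ℝ) + 1) / 2) = 2 ^ r := by
    rw [← Real.rpow_add (by norm_num), ← Real.rpow_natCast]
    congr 1; push_cast; ring
  have h3 : (2 : ℝ) ^ ((r : ℝ) / 2 - 1) ≠ 0 := by positivity
  have h4 : (2 : ℝ) ^ ((((r + 1 : ℕ) : ℝ) + 1) / 2) ≠ 0 := by positivity
  rw [← h2, show (((r + 1 : ℕ) : ℝ) / 2 + 1) = ((r : ℝ) + 3) / 2 by push_cast; ring]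
  field_simp
end
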